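/- arXiv:1711.04724 — 2 statements merged into one kernel-verified Lean document; each statement's English description precedes it below -/
import Mathlib

section
/- Let A be a C*-algebra and let E be a full Hilbert A-module. Let U, V : E → E be adjointable isometries with UU* = VV* = id (so U, V are unitary module maps onto their ranges with UU* and VV* the identity). Then the implication '⟨x, y⟩ = 0 ⟹ ⟨U(x), V(y)⟩ = 0 for all x, y ∈ E' holds if and only if either ⟨U(x), V(y)⟩ = 0 for all x, y ∈ E (i.e., U(E) ⊥ V(E)), or there exists a unitary element γ ∈ Z(M(A)) such that ⟨U(x), z⟩ = γ·⟨V(x), z⟩ for all x, z ∈ E (i.e., U = γV). -/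
open MultiplierAlgebra

/-- A Hilbert module over a C*-algebra `A`: a (left) `A`-module `E` together with an `A`-valued
inner product which is `ℂ`-linear and `A`-linear in the first variable, conjugate symmetric and
positive definite, such that the norm of `E` is the induced norm `‖x‖ = ‖⟪x, x⟫‖^(1/2)`
(completeness is the type class `CompleteSpace E`). -/
structure CStarNormedInnerProductModule (A E : Type*) [NonUnitalCStarAlgebra A]
    [PartialOrder A] [StarOrderedRing A]
    [NormedAddCommGroup E] [Module ℂ E] [SMul A E] where
  inner : E → E → A
  add_left : ∀ x y z : E, inner (x + y) z = inner x z + inner y z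
  smulC_left : ∀ (c : ℂ) (x y : E), inner (c • x) y = c • inner x y
  smulA_left : ∀ (a : A) (x y : E), inner (a • x) y = a * inner x y
  star_inner : ∀ x y : E, star (inner x y) = inner y x
  inner_self_nonneg : ∀ x : E, 0 ≤ inner x x
  inner_self_eq_zero : ∀ x : E, inner x x = 0 ↔ x = 0
  smul_add : ∀ (a : A) (x y : E), a • (x + y) = a • x + a • y
  add_smul : ∀ (a b : A) (x : E), (a + b) • x = a • x + b • x
  mul_smul : ∀ (a b : A) (x : E), (a * b) • x = a • (b • x)
  smul_assoc : ∀ (c : ℂ) (a : A) (x : E), (c • a) • x = c • (a • x)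
  norm_eq : ∀ x : E, ‖x‖ ^ 2 = ‖inner x x‖

/-- A Hilbert C*-module is *full* when the closed linear span of all inner products is the
whole coefficient algebra. -/
def CStarNormedInnerProductModule.IsFull {A E : Type*} [NonUnitalCStarAlgebra A]
    [PartialOrder A] [StarOrderedRing A] [NormedAddCommGroup E] [Module ℂ E] [SMul A E]
    (M : CStarNormedInnerProductModule A E) : Prop :=
  (Submodule.span ℂ {a : A | ∃ x y : E, a = M.inner x y}).topologicalClosure = ⊤

open NormedSpace (exp) in
/-- A selfadjoint element of a C⋆-algebra that commutes with its commutator with `c` commutes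
with `c`. -/
theorem commute_of_commute_commutator {B : Type*} [CStarAlgebra B] {a c : B}
    (ha : IsSelfAdjoint a) (h : Commute a (a * c - c * a)) : Commute a c := by
  let _ : NormedAlgebra ℚ B := .restrictScalars ℚ ℂ B
  set d := a * c - c * a with hd
  have key (z : ℂ) : exp (z • a) * c * exp (z • (-a)) = c + z • d := by
    have hder (z : ℂ) : HasDerivAt
        (fun z : ℂ ↦ exp (z • a) * c * exp (z • (-a)) - z • d) 0 z := by
      have h1 := ((hasDerivAt_exp_smul_const a z).mul_const c).mul
        (hasDerivAt_exp_smul_const' (-a) z)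
      have h2 := h1.sub ((hasDerivAt_id z).smul_const d)
      refine h2.congr_deriv ?_
      have hcomm : Commute d (exp (z • (-a))) :=
        (h.symm.neg_right.smul_right z).exp_right
      have hinv : exp (z • a) * exp (z • (-a)) = 1 := by
        rw [smul_neg, ← NormedSpace.exp_add_of_commute (Commute.refl _).neg_right]
        simp
      calc _ = exp (z • a) * (d * exp (z • (-a))) - d := by
            rw [hd]; simp only [one_smul]; noncomm_ring
        _ = 0 := by rw [hcomm.eq, ← mul_assoc, hinv, one_mul, sub_self]
    have hconst := is_const_of_deriv_eq_zero (fun z ↦ (hder z).differentiableAt)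
      (fun z ↦ (hder z).deriv) z 0
    simp only [zero_smul, NormedSpace.exp_zero, one_mul, mul_one, sub_zero] at hconst
    exact sub_eq_iff_eq_add.1 hconst
  have hbd (t : ℝ) : t * ‖d‖ ≤ 2 * ‖c‖ := by
    have hn (s : B) (hs : IsSelfAdjoint s) : exp ((t * Complex.I) • s) ∈ unitary B := by
      have := (selfAdjoint.expUnitary (t • (⟨s, hs⟩ : selfAdjoint B))).2
      rw [selfAdjoint.expUnitary_coe] at this
      convert this using 2
      change _ = Complex.I • t • s
      rw [mul_comm, mul_smul]
      rfl
    have h1 := key (t * Complex.I)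
    have h2 : ‖c + (t * Complex.I) • d‖ = ‖c‖ := by
      rw [← h1, CStarRing.norm_mul_mem_unitary _ (hn _ ha.neg),
        CStarRing.norm_mem_unitary_mul _ (hn _ ha)]
    calc t * ‖d‖ ≤ |t| * ‖d‖ := by gcongr; exact le_abs_self t
      _ = ‖(c + (t * Complex.I) • d) - c‖ := by simp [norm_smul]
      _ ≤ 2 * ‖c‖ := (norm_sub_le _ _).trans (by rw [h2, two_mul])
  have : d = 0 := by
    by_contra hne
    have hpos := norm_pos_iff.2 hne
    have := hbd ((2 * ‖c‖ + 1) / ‖d‖)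
    rw [div_mul_cancel₀ _ hpos.ne'] at this
    linarith
  exact sub_eq_zero.1 this

theorem integral_abs_sub {M t : ℝ} (h1 : -M ≤ t) (h2 : t ≤ M) :
    ∫ l in (-M)..M, |t - l| = M ^ 2 + t ^ 2 := by
  have e1 : ∫ l in (-M)..t, |t - l| = ∫ l in (-M)..t, (t - l) :=
    intervalIntegral.integral_congr fun l hl ↦ by
      rw [Set.uIcc_of_le h1] at hl
      exact abs_of_nonneg (by linarith [hl.2])
  have e2 : ∫ l in t..M, |t - l| = ∫ l in t..M, (l - t) :=
    intervalIntegral.integral_congr fun l hl ↦ by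
      rw [Set.uIcc_of_le h2] at hl
      exact (abs_of_nonpos (by linarith [hl.1])).trans (by ring)
  rw [← intervalIntegral.integral_add_adjacent_intervals (b := t)
    (Continuous.intervalIntegrable (by fun_prop) _ _)
    (Continuous.intervalIntegrable (by fun_prop) _ _), e1, e2,
    intervalIntegral.integral_sub (by simp) (by simp),
    intervalIntegral.integral_sub (by simp) (by simp)]
  simp
  ring

theorem integral_mul_abs_sub {M t : ℝ} (h1 : -M ≤ t) (h2 : t ≤ M) :
    ∫ l in (-M)..M, l * |t - l| = t ^ 3 / 3 - t * M ^ 2 := by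
  have e1 : ∫ l in (-M)..t, l * |t - l| = ∫ l in (-M)..t, (t * l - l ^ 2) :=
    intervalIntegral.integral_congr fun l hl ↦ by
      rw [Set.uIcc_of_le h1] at hl
      simp only [abs_of_nonneg (show 0 ≤ t - l by linarith [hl.2])]
      ring
  have e2 : ∫ l in t..M, l * |t - l| = ∫ l in t..M, (l ^ 2 - t * l) :=
    intervalIntegral.integral_congr fun l hl ↦ by
      rw [Set.uIcc_of_le h2] at hl
      simp only [abs_of_nonpos (show t - l ≤ 0 by linarith [hl.1])]
      ring
  have i1 (p q : ℝ) : IntervalIntegrable (fun l : ℝ ↦ t * l) MeasureTheory.volume p q :=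
    Continuous.intervalIntegrable (by fun_prop) _ _
  have i2 (p q : ℝ) : IntervalIntegrable (fun l : ℝ ↦ l ^ 2) MeasureTheory.volume p q :=
    Continuous.intervalIntegrable (by fun_prop) _ _
  rw [← intervalIntegral.integral_add_adjacent_intervals (b := t)
    (Continuous.intervalIntegrable (by fun_prop) _ _)
    (Continuous.intervalIntegrable (by fun_prop) _ _), e1, e2,
    intervalIntegral.integral_sub (i1 _ _) (i2 _ _),
    intervalIntegral.integral_sub (i2 _ _) (i1 _ _),
    intervalIntegral.integral_const_mul, intervalIntegral.integral_const_mul]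
  simp
  ring

open MeasureTheory in
theorem cfc_intervalIntegral_and_integrable {B : Type*} [CStarAlgebra B] (a : B)
    (ha : IsSelfAdjoint a) {f : ℝ → ℝ → ℝ} (hf : Continuous (Function.uncurry f)) {p q : ℝ}
    (hpq : p ≤ q) :
    IntervalIntegrable (fun l ↦ cfc (f l) a) volume p q ∧
      cfc (fun t ↦ ∫ l in p..q, f l t) a = ∫ l in p..q, cfc (f l) a := by
  obtain ⟨C, hC⟩ := ((isCompact_Icc (a := p) (b := q)).prod
    (spectrum.isCompact (𝕜 := ℝ) a)).exists_bound_of_continuousOn hf.continuousOn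
  have hb : ∀ᵐ l ∂(volume.restrict (Set.Ioc p q)), ∀ z ∈ spectrum ℝ a, ‖f l z‖ ≤ C :=
    ae_restrict_of_forall_mem measurableSet_Ioc fun l hl z hz ↦
      hC (l, z) ⟨Set.Ioc_subset_Icc_self hl, hz⟩
  have hC' : HasFiniteIntegral (fun _ : ℝ ↦ C) (volume.restrict (Set.Ioc p q)) :=
    (integrable_const C).2
  simp only [intervalIntegral.integral_of_le hpq]
  rw [intervalIntegrable_iff_integrableOn_Ioc_of_le hpq]
  exact ⟨integrableOn_cfc measurableSet_Ioc f _ a hf.continuousOn hb hC',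
    cfc_setIntegral measurableSet_Ioc f _ a hf.continuousOn hb hC'⟩

/-- If `f(a) b g(a) = 0` for all continuous `f`, `g` with `f g = 0`, then `a` commutes with `b`:
integrating `(a - l) b |a - l| = |a - l| b (a - l)` over `l` shows that the third iterated
commutator of `a` with `b` vanishes. -/
theorem commute_of_cfc_mul_mul_cfc_eq_zero {B : Type*} [CStarAlgebra B] {a b : B}
    (ha : IsSelfAdjoint a)
    (H : ∀ f g : ℝ → ℝ, Continuous f → Continuous g → (∀ t, f t * g t = 0) →
      cfc f a * b * cfc g a = 0) : Commute a b := by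
  have hswap (l : ℝ) : (a - algebraMap ℝ B l) * b * cfc (fun t ↦ |t - l|) a -
      cfc (fun t ↦ |t - l|) a * b * (a - algebraMap ℝ B l) = 0 := by
    have hdisj (t : ℝ) : max (t - l) 0 * max (-(t - l)) 0 = 0 := by
      rcases le_total (t - l) 0 with h | h
      · simp [h]
      · rw [max_eq_right (a := -(t - l)) (by linarith), mul_zero]
    have h1 := H (fun t ↦ max (t - l) 0) (fun t ↦ max (-(t - l)) 0) (by fun_prop) (by fun_prop)
      hdisj
    have h2 := H (fun t ↦ max (-(t - l)) 0) (fun t ↦ max (t - l) 0) (by fun_prop) (by fun_prop)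
      fun t ↦ (mul_comm _ _).trans (hdisj t)
    have e1 : a - algebraMap ℝ B l =
        cfc (fun t ↦ max (t - l) 0) a - cfc (fun t ↦ max (-(t - l)) 0) a := by
      rw [← cfc_sub _ _ a (by fun_prop) (by fun_prop)]
      conv_lhs => rw [← cfc_id' ℝ a, ← cfc_const l a, ← cfc_sub _ _ a (by fun_prop) (by fun_prop)]
      congr! 2 with t
      exact (max_zero_sub_max_neg_zero_eq_self (t - l)).symm
    have e2 : cfc (fun t ↦ |t - l|) a =
        cfc (fun t ↦ max (t - l) 0) a + cfc (fun t ↦ max (-(t - l)) 0) a := by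
      rw [← cfc_add a _ _ (by fun_prop) (by fun_prop)]
      congr! 2 with t
      exact (max_zero_add_max_neg_zero_eq_abs_self (t - l)).symm
    rw [e1, e2]
    set p := cfc (fun t ↦ max (t - l) 0) a
    set q := cfc (fun t ↦ max (-(t - l)) 0) a
    calc _ = 2 • (p * b * q) - 2 • (q * b * p) := by noncomm_ring
      _ = 0 := by rw [h1, h2]; simp
  set M : ℝ := ‖a‖ * ‖(1 : B)‖
  have hM : -M ≤ M := neg_le_self (by positivity)
  have hspec (t : ℝ) (ht : t ∈ spectrum ℝ a) : -M ≤ t ∧ t ≤ M :=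
    abs_le.1 (spectrum.norm_le_norm_mul_of_mem ht)
  obtain ⟨iN, hN⟩ := cfc_intervalIntegral_and_integrable a ha
    (f := fun l t ↦ |t - l|) (by fun_prop) hM
  obtain ⟨iL, hL⟩ := cfc_intervalIntegral_and_integrable a ha
    (f := fun l t ↦ l * |t - l|) (by fun_prop) hM
  rw [cfc_congr (g := fun t ↦ M ^ 2 + t ^ 2)
    fun t ht ↦ integral_abs_sub (hspec t ht).1 (hspec t ht).2] at hN
  rw [cfc_congr (g := fun t ↦ t ^ 3 / 3 - t * M ^ 2)
    fun t ht ↦ integral_mul_abs_sub (hspec t ht).1 (hspec t ht).2] at hL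
  have eN : cfc (fun t : ℝ ↦ M ^ 2 + t ^ 2) a = M ^ 2 • 1 + a ^ 2 := by
    rw [cfc_add a _ _ (by fun_prop) (by fun_prop), cfc_const _ a, cfc_pow_id (R := ℝ) a 2,
      Algebra.algebraMap_eq_smul_one]
  have eL : cfc (fun t : ℝ ↦ t ^ 3 / 3 - t * M ^ 2) a = (3⁻¹ : ℝ) • a ^ 3 - M ^ 2 • a := by
    rw [cfc_sub _ _ a (by fun_prop) (by fun_prop)]
    simp_rw [div_eq_inv_mul, mul_comm _ (M ^ 2)]
    rw [cfc_const_mul _ _ a (by fun_prop), cfc_const_mul _ _ a (by fun_prop),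
      cfc_pow_id (R := ℝ) a 3, cfc_id' ℝ a]
  have hint : ∫ l in (-M)..M, (a * b * cfc (fun t ↦ |t - l|) a - b * cfc (fun t ↦ l * |t - l|) a
      - (cfc (fun t ↦ |t - l|) a * (b * a) - cfc (fun t ↦ l * |t - l|) a * b)) = 0 := by
    rw [← intervalIntegral.integral_zero (a := -M) (b := M)]
    congr! 2 with l
    rw [← hswap l, cfc_const_mul _ _ a (by fun_prop), Algebra.algebraMap_eq_smul_one]
    simp only [sub_mul, mul_sub, smul_mul_assoc, mul_smul_comm, one_mul, mul_one, mul_assoc]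
  have hconst (x : B) {f : ℝ → B} (hf : IntervalIntegrable f MeasureTheory.volume (-M) M) :
      ∫ l in (-M)..M, x * f l = x * ∫ l in (-M)..M, f l :=
    (ContinuousLinearMap.mul ℝ B x).intervalIntegral_comp_comm hf
  have hconst' (x : B) {f : ℝ → B} (hf : IntervalIntegrable f MeasureTheory.volume (-M) M) :
      ∫ l in (-M)..M, f l * x = (∫ l in (-M)..M, f l) * x :=
    ((ContinuousLinearMap.mul ℝ B).flip x).intervalIntegral_comp_comm hf
  rw [intervalIntegral.integral_sub ((iN.const_mul _).sub (iL.const_mul _))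
      ((iN.mul_const _).sub (iL.mul_const _)),
    intervalIntegral.integral_sub (iN.const_mul _) (iL.const_mul _),
    intervalIntegral.integral_sub (iN.mul_const _) (iL.mul_const _),
    hconst _ iN, hconst _ iL, hconst' _ iN, hconst' _ iL,
    ← hN, ← hL, eN, eL] at hint
  have hcube : a * (a * (a * b - b * a) - (a * b - b * a) * a) =
      (a * (a * b - b * a) - (a * b - b * a) * a) * a := by
    rw [← sub_eq_zero, ← smul_zero (3 : ℝ), ← hint]
    simp only [sub_mul, mul_sub, add_mul, mul_add, smul_sub, smul_add, smul_mul_assoc,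
      mul_smul_comm, smul_smul, mul_inv_cancel₀ (three_ne_zero (α := ℝ)), one_smul, one_mul,
      mul_one, mul_assoc, pow_succ, pow_zero]
    module
  exact commute_of_commute_commutator ha (commute_of_commute_commutator ha hcube)

theorem mul_sq_eq_zero_of_mul_cfc_eq_zero {B : Type*} [CStarAlgebra B] {a c : B}
    (ha : IsSelfAdjoint a)
    (h : ∀ ε : ℝ, 0 < ε → c * cfc (fun t : ℝ ↦ max (t ^ 2 - ε) 0) a = 0) : c * a ^ 2 = 0 := by
  have hbd (ε : ℝ) (hε : 0 < ε) : ‖c * a ^ 2‖ ≤ ‖c‖ * ε := by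
    have hdiff : ‖a ^ 2 - cfc (fun t : ℝ ↦ max (t ^ 2 - ε) 0) a‖ ≤ ε := by
      rw [← cfc_pow_id (R := ℝ) a 2, ← cfc_sub _ _ a (by fun_prop) (by fun_prop)]
      refine norm_cfc_le hε.le fun t _ ↦ ?_
      rw [Real.norm_eq_abs, abs_le]
      rcases max_cases (t ^ 2 - ε) 0 with ⟨h1, h2⟩ | ⟨h1, h2⟩ <;> rw [h1] <;>
        constructor <;> nlinarith [sq_nonneg t]
    calc ‖c * a ^ 2‖ = ‖c * (a ^ 2 - cfc (fun t : ℝ ↦ max (t ^ 2 - ε) 0) a)‖ := by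
          rw [mul_sub, h ε hε, sub_zero]
      _ ≤ ‖c‖ * ε := (norm_mul_le _ _).trans (by gcongr)
  refine norm_le_zero_iff.1 (ge_of_tendsto (x := nhdsWithin (0 : ℝ) (Set.Ioi 0))
    (f := fun ε ↦ ‖c‖ * ε) ?_ ?_)
  · exact ((continuous_const.mul continuous_id).tendsto' 0 0 (by simp)).mono_left
      nhdsWithin_le_nhds
  · filter_upwards [self_mem_nhdsWithin] with ε hε using hbd ε hε

/-- If `W` is an adjointable map on a pre-Hilbert module over a unital C⋆-algebra such that
`⟪x, y⟫ = 0` implies `⟪W x, y⟫ = 0`, then `W` commutes with the maps `x ↦ ⟪x, y⟫ • y`. -/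
theorem inner_map_mul_inner {B E : Type*} [CStarAlgebra B] [AddCommGroup E]
    {ip : E → E → B} {act : B → E → E}
    (add_left : ∀ x y z, ip (x + y) z = ip x z + ip y z)
    (act_left : ∀ b x y, ip (act b x) y = b * ip x y)
    (star_ip : ∀ x y, star (ip x y) = ip y x)
    (definite : ∀ x, ip x x = 0 → x = 0)
    {W W' : E → E} (adj : ∀ x y, ip (W x) y = ip x (W' y))
    (hW : ∀ x y, ip x y = 0 → ip (W x) y = 0) (x y z : E) :
    ip (W x) y * ip y z = ip x y * ip (W y) z := by
  have act_right (b x y) : ip x (act b y) = ip x y * star b := by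
    rw [← star_ip, act_left, star_mul, star_ip]
  have W_add (x y z) : ip (W (x + y)) z = ip (W x) z + ip (W y) z := by
    simp only [adj, add_left]
  have W_act (b x y) : ip (W (act b x)) y = b * ip (W x) y := by
    simp only [adj, act_left]
  have zero_left (z) : ip 0 z = 0 := by simpa using add_left 0 0 z
  have symm_zero {x y} (h : ip x y = 0) : ip y x = 0 := by rw [← star_ip, h, star_zero]
  set a := ip y y with ha_def
  set b := ip (W y) y with hb_def
  have ha : IsSelfAdjoint a := star_ip y y
  have star_cfc (f : ℝ → ℝ) : star (cfc f a) = cfc f a := (cfc_predicate f a).star_eq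
  have hab : Commute a b := by
    refine commute_of_cfc_mul_mul_cfc_eq_zero ha fun f g hf hg hfg ↦ ?_
    have h := hW (act (cfc f a) y) (act (cfc g a) y) <| by
      rw [act_left, act_right, star_cfc, ← ha_def]
      nth_rewrite 2 [← cfc_id ℝ a]
      rw [← cfc_mul _ _ a continuousOn_id hg.continuousOn,
        ← cfc_mul _ _ a hf.continuousOn (by fun_prop),
        ← cfc_const_zero ℝ a]
      congr! 2 with t
      simp only [id]
      linear_combination t * hfg t
    rwa [W_act, act_right, star_cfc, ← hb_def, ← mul_assoc] at h
  set d := act (ip (W x) y) y + act (-ip x y) (W y) with hd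
  have hip (w) : ip d w = ip (W x) y * ip y w - ip x y * ip (W y) w := by
    rw [hd, add_left, act_left, act_left, neg_mul, sub_eq_add_neg]
  set c := ip d y with hc
  have hca2 : c * a ^ 2 = 0 := by
    refine mul_sq_eq_zero_of_mul_cfc_eq_zero ha fun ε hε ↦ ?_
    set h := cfc (fun t : ℝ ↦ max (t ^ 2 - ε) 0) a with hh
    set r := cfc (fun t : ℝ ↦ t / max (t ^ 2) ε) a with hr
    have hr_cont : Continuous fun t : ℝ ↦ t / max (t ^ 2) ε :=
      continuous_id.div (by fun_prop) fun t ↦ (lt_max_of_lt_right hε).ne'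
    have hrah : r * (a * h) = h := by
      rw [hh, hr]
      nth_rewrite 2 [← cfc_id ℝ a]
      rw [← cfc_mul _ _ a continuousOn_id (by fun_prop),
        ← cfc_mul _ _ a hr_cont.continuousOn (by fun_prop)]
      congr! 2 with t
      rcases le_total (t ^ 2) ε with ht | ht
      · simp [max_eq_right (sub_nonpos.2 ht)]
      · rw [max_eq_left ht, max_eq_left (sub_nonneg.2 ht), id]
        have : t ≠ 0 := by rintro rfl; norm_num at ht; linarith
        field_simp
    have hstar : star h = h := star_cfc _
    have hrb : r * b = b * r := (hab.cfc_real _).eq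
    have hha : h * a = a * h := ((Commute.refl a).cfc_real _).eq
    clear_value h r
    have horth := hW (x + act (-(ip x y * r)) y) (act h y) <| by
      rw [act_right, hstar, add_left, act_left, ← ha_def]
      calc _ = ip x y * h - ip x y * (r * (a * h)) := by noncomm_ring
        _ = 0 := by rw [hrah, sub_self]
    rw [act_right, hstar, W_add, W_act, ← hb_def] at horth
    have hxh : ip (W x) y * h = ip x y * (b * (r * h)) := by
      rw [← sub_eq_zero, ← horth, ← mul_assoc b, ← hrb]; noncomm_ring
    calc c * h = ip (W x) y * h * a - ip x y * b * h := by
          rw [hc, hip, ← ha_def, ← hb_def, mul_assoc _ h a, hha]; noncomm_ring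
      _ = ip x y * b * (r * (h * a)) - ip x y * b * h := by rw [hxh]; noncomm_ring
      _ = 0 := by rw [hha, hrah, sub_self]
  have hca : c * a = 0 := by
    rw [← CStarRing.mul_star_self_eq_zero_iff, star_mul, ha.star_eq, mul_assoc, ← mul_assoc a,
      ← sq, ← mul_assoc, hca2, zero_mul]
  have hcy : act c y = 0 := definite _ <| by
    rw [act_left, act_right, ← ha_def, ← mul_assoc, hca, zero_mul]
  have hc0 : ip d y = 0 := by
    rw [← CStarRing.mul_star_self_eq_zero_iff, star_ip, ← hc, ← act_left, hcy, zero_left]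
  have hd0 : d = 0 := definite _ <| by
    rw [hip, symm_zero hc0, hW _ _ (symm_zero hc0), mul_zero, mul_zero, sub_zero]
  rw [← sub_eq_zero, ← hip, hd0, zero_left]

namespace CStarNormedInnerProductModule

variable {A E : Type*} [NonUnitalCStarAlgebra A] [PartialOrder A] [StarOrderedRing A]
  [NormedAddCommGroup E] [Module ℂ E] [SMul A E] (M : CStarNormedInnerProductModule A E)

theorem smulC_right (c : ℂ) (x y : E) : M.inner x (c • y) = star c • M.inner x y := by
  rw [← M.star_inner, M.smulC_left, star_smul, M.star_inner]

theorem add_right (x y z : E) : M.inner x (y + z) = M.inner x y + M.inner x z := by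
  rw [← M.star_inner, M.add_left, star_add, M.star_inner, M.star_inner]

theorem ext_inner_left {x y : E} (h : ∀ z, M.inner x z = M.inner y z) : x = y := by
  have hs (z) : M.inner (x - y) z = 0 := by
    have := M.add_left (x - y) y z
    rwa [sub_add_cancel, h, right_eq_add] at this
  exact sub_eq_zero.1 ((M.inner_self_eq_zero _).1 (hs _))

theorem inner_map_mul_inner_self {W W' : E → E}
    (adj : ∀ x y, M.inner (W x) y = M.inner x (W' y))
    (hW : ∀ x y, M.inner x y = 0 → M.inner (W x) y = 0) (x y z : E) :
    M.inner (W x) y * M.inner y z = M.inner x y * M.inner (W y) z := by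
  have h := inner_map_mul_inner (B := Unitization ℂ A)
    (ip := fun x y ↦ (M.inner x y : Unitization ℂ A))
    (act := fun b x ↦ b.fst • x + b.snd • x) (W := W) (W' := W')
    (fun x y z ↦ by rw [M.add_left, Unitization.inr_add])
    (fun b x y ↦ by
      ext <;> simp [M.add_left, M.smulC_left, M.smulA_left])
    (fun x y ↦ by rw [← Unitization.inr_star, M.star_inner])
    (fun x hx ↦ (M.inner_self_eq_zero x).1 (Unitization.inr_injective hx))
    (fun x y ↦ by rw [adj])
    (fun x y hxy ↦ by
      rw [hW x y (Unitization.inr_injective hxy), Unitization.inr_zero]) x y z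
  simp only [← Unitization.inr_mul] at h
  exact Unitization.inr_injective h

theorem inner_map_mul_inner {W W' : E → E}
    (adj : ∀ x y, M.inner (W x) y = M.inner x (W' y))
    (hW : ∀ x y, M.inner x y = 0 → M.inner (W x) y = 0) (x y w z : E) :
    M.inner (W x) y * M.inner w z = M.inner x y * M.inner (W w) z := by
  have W_add (x y z) : M.inner (W (x + y)) z = M.inner (W x) z + M.inner (W y) z := by
    simp only [adj, M.add_left]
  have W_smul (c : ℂ) (x y) : M.inner (W (c • x)) y = c • M.inner (W x) y := by
    simp only [adj, M.smulC_left]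
  have key := M.inner_map_mul_inner_self adj hW
  have hp (c : ℂ) : star c • (M.inner (W x) w * M.inner y z - M.inner x w * M.inner (W y) z) +
      c • (M.inner (W x) y * M.inner w z - M.inner x y * M.inner (W w) z) = 0 := by
    have h := key x (y + c • w) z
    simp only [M.add_left, M.add_right, W_add, W_smul, M.smulC_left, M.smulC_right, mul_add,
      add_mul, smul_mul_assoc, mul_smul_comm, key x y z, key x w z] at h
    rw [← sub_eq_zero] at h
    rw [← h]
    module
  have h1 := hp 1
  have hI := hp Complex.I
  rw [star_one, one_smul, one_smul] at h1
  rw [eq_neg_of_add_eq_zero_left h1, smul_neg, ← neg_smul, ← _root_.add_smul] at hI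
  rw [← sub_eq_zero]
  refine (smul_eq_zero.1 hI).resolve_left ?_
  simp [Complex.ext_iff]

end CStarNormedInnerProductModule

/-- A closed linear relation on `A` with dense domain which is compatible with multiplication and
adjoints is the graph of a central unitary multiplier. -/
theorem DoubleCentralizer.exists_mem_center_of_graph {A : Type*} [NonUnitalCStarAlgebra A]
    (S : Submodule ℂ (A × A)) (hclosed : IsClosed (S : Set (A × A)))
    (hmul : ∀ p ∈ S, ∀ q ∈ S, p.2 * q.1 = p.1 * q.2)
    (hstar : ∀ p ∈ S, (star p.2, star p.1) ∈ S)
    (hdense : Dense (Prod.fst '' (S : Set (A × A)))) :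
    ∃ γ : 𝓜(ℂ, A), γ ∈ Set.center 𝓜(ℂ, A) ∧ star γ * γ = 1 ∧ γ * star γ = 1 ∧
      ∀ p ∈ S, γ.fst p.1 = p.2 := by
  have hnorm (p) (hp : p ∈ S) : ‖p.2‖ = ‖p.1‖ := by
    have h := congrArg norm (hmul p hp _ (hstar p hp))
    rw [CStarRing.norm_self_mul_star, CStarRing.norm_self_mul_star] at h
    nlinarith [norm_nonneg p.1, norm_nonneg p.2]
  have : CompleteSpace S := hclosed.completeSpace_coe
  let f : S →ₗᵢ[ℂ] A :=
    { toLinearMap := (LinearMap.fst ℂ A A).comp S.subtype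
      norm_map' := fun p ↦ by
        change ‖p.1.1‖ = max ‖p.1.1‖ ‖p.1.2‖
        rw [hnorm p.1 p.2, max_self] }
  have hf : Function.Surjective f := by
    rw [← Set.range_eq_univ, ← f.isometry.isClosedEmbedding.isClosed_range.closure_eq]
    have : Set.range f = Prod.fst '' (S : Set (A × A)) := by
      ext a; simp [f]
    rw [this, hdense.closure_eq]
  let e := LinearIsometryEquiv.ofSurjective f hf
  let T : A →L[ℂ] A := (ContinuousLinearMap.snd ℂ A A).comp
    (S.subtypeL.comp (e.symm.toContinuousLinearEquiv : A →L[ℂ] S))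
  have hT (p) (hp : p ∈ S) : T p.1 = p.2 := by
    change (e.symm (e ⟨p, hp⟩)).1.2 = p.2
    rw [e.symm_apply_apply]
  have hmem (a : A) : (a, T a) ∈ S := by
    obtain ⟨p, rfl⟩ := e.surjective a
    have : ((e p, T (e p)) : A × A) = p.1 := Prod.ext rfl (hT p.1 p.2)
    rw [this]
    exact p.2
  have hcentral (a b : A) : T a * b = a * T b := hmul _ (hmem a) _ (hmem b)
  have hTstar (a : A) : T (star (T (star a))) = a := by
    simpa using hT _ (hstar _ (hmem (star a)))
  have hTstar' (a : A) : star (T (star (T a))) = a := by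
    simpa using congrArg star (hTstar (star a))
  have ext_left {a b : A} (h : ∀ c, a * c = b * c) : a = b := by
    rw [← sub_eq_zero, ← CStarRing.mul_star_self_eq_zero_iff, sub_mul, h, sub_self]
  have ext_right {a b : A} (h : ∀ c, c * a = c * b) : a = b := by
    rw [← sub_eq_zero, ← CStarRing.star_mul_self_eq_zero_iff, mul_sub, h, sub_self]
  refine ⟨⟨(T, T), hcentral⟩, ?_, ?_, ?_, hT⟩
  · have hfst (m : 𝓜(ℂ, A)) (a b : A) : m.fst (a * b) = m.fst a * b :=
      ext_right fun c ↦ by rw [← m.central, ← mul_assoc, ← mul_assoc, m.central]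
    have hsnd (m : 𝓜(ℂ, A)) (a b : A) : m.snd (a * b) = a * m.snd b :=
      ext_left fun c ↦ by rw [m.central, mul_assoc, mul_assoc, m.central]
    rw [Semigroup.mem_center_iff]
    refine fun m ↦ DoubleCentralizer.ext _ _ _ _ (Prod.ext ?_ ?_)
    · ext a
      change m.fst (T a) = T (m.fst a)
      exact ext_left fun c ↦ by rw [← hfst, hcentral, hcentral, hfst]
    · ext a
      change T (m.snd a) = m.snd (T a)
      exact ext_right fun c ↦ by rw [← hsnd, ← hcentral, ← hcentral, hsnd]
  all_goals
    refine DoubleCentralizer.ext _ _ _ _ (Prod.ext ?_ ?_) <;> ext a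
  exacts [hTstar' a, hTstar a, hTstar a, hTstar' a]

namespace CStarNormedInnerProductModule

variable {A E : Type*} [NonUnitalCStarAlgebra A] [PartialOrder A] [StarOrderedRing A]
  [NormedAddCommGroup E] [Module ℂ E] [SMul A E] (M : CStarNormedInnerProductModule A E)

/-- On a full Hilbert module, a unitary `W` such that `⟪x, y⟫ = 0` implies `⟪W x, y⟫ = 0` is
given by a central unitary multiplier. -/
theorem exists_unitary_mem_center_inner_map_eq (hfull : M.IsFull) {W W' : E → E}
    (adj : ∀ x y, M.inner (W x) y = M.inner x (W' y))
    (iso : ∀ x y, M.inner (W x) (W y) = M.inner x y)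
    (hW : ∀ x y, M.inner x y = 0 → M.inner (W x) y = 0) :
    ∃ γ : 𝓜(ℂ, A), γ ∈ Set.center 𝓜(ℂ, A) ∧ star γ * γ = 1 ∧ γ * star γ = 1 ∧
      ∀ x y, γ.fst (M.inner x y) = M.inner (W x) y := by
  set G : Set (A × A) := {p | ∃ x y, p = (M.inner x y, M.inner (W x) y)}
  set S : Submodule ℂ (A × A) := (Submodule.span ℂ G).topologicalClosure
  have hS_induction {P : A × A → Prop} (hclosed : IsClosed {p | P p})
      (hgen : ∀ x y, P (M.inner x y, M.inner (W x) y)) (hzero : P 0)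
      (hadd : ∀ p q, P p → P q → P (p + q)) (hsmul : ∀ (c : ℂ) p, P p → P (c • p)) :
      ∀ p ∈ S, P p := by
    have hspan : (Submodule.span ℂ G : Set (A × A)) ⊆ {p | P p} := fun p hp ↦ by
      induction hp using Submodule.span_induction with
      | mem p hp => obtain ⟨x, y, rfl⟩ := hp; exact hgen x y
      | zero => exact hzero
      | add p q _ _ hp hq => exact hadd p q hp hq
      | smul c p _ hp => exact hsmul c p hp
    exact fun p hp ↦ closure_minimal hspan hclosed hp
  have hGS (x y) : (M.inner x y, M.inner (W x) y) ∈ S :=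
    Submodule.le_topologicalClosure _ (Submodule.subset_span ⟨x, y, rfl⟩)
  have hS_closed : IsClosed (S : Set (A × A)) := Submodule.isClosed_topologicalClosure _
  have hmul : ∀ p ∈ S, ∀ q ∈ S, p.2 * q.1 = p.1 * q.2 := by
    refine hS_induction ?_ (fun x y ↦ hS_induction ?_ (fun w z ↦ ?_) ?_ ?_ ?_) ?_ ?_ ?_
    · simp only [Set.ofPred_forall]
      exact isClosed_iInter fun q ↦ isClosed_iInter fun _ ↦
        isClosed_eq (by fun_prop) (by fun_prop)
    · exact isClosed_eq (by fun_prop) (by fun_prop)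
    · exact M.inner_map_mul_inner adj hW x y w z
    · simp
    · intro p q hp hq
      simp only [Prod.fst_add, Prod.snd_add, mul_add, hp, hq]
    · intro c p hp
      simp only [Prod.smul_fst, Prod.smul_snd, mul_smul_comm, hp]
    · simp
    · intro p q hp hq r hr
      simp only [Prod.fst_add, Prod.snd_add, add_mul, hp r hr, hq r hr]
    · intro c p hp r hr
      simp only [Prod.smul_fst, Prod.smul_snd, smul_mul_assoc, hp r hr]
  have hstar : ∀ p ∈ S, (star p.2, star p.1) ∈ S := by
    refine hS_induction ?_ (fun x y ↦ ?_) ?_ (fun p q hp hq ↦ ?_) (fun c p hp ↦ ?_)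
    · exact hS_closed.preimage (f := fun p : A × A ↦ (star p.2, star p.1)) (by fun_prop)
    · simpa only [M.star_inner, iso] using hGS y (W x)
    · simp [← Prod.zero_eq_mk]
    · simpa using S.add_mem hp hq
    · simpa using S.smul_mem (star c) hp
  have hdense : Dense (Prod.fst '' (S : Set (A × A))) := by
    have h : Dense (Submodule.span ℂ {a : A | ∃ x y : E, a = M.inner x y} : Set A) :=
      (Submodule.dense_iff_topologicalClosure_eq_top).2 hfull
    refine h.mono ?_
    change _ ≤ S.map (LinearMap.fst ℂ A A)
    rw [Submodule.span_le]
    rintro _ ⟨x, y, rfl⟩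
    exact ⟨_, hGS x y, rfl⟩
  obtain ⟨γ, hγ, h1, h2, h3⟩ :=
    DoubleCentralizer.exists_mem_center_of_graph S hS_closed hmul hstar hdense
  exact ⟨γ, hγ, h1, h2, fun x y ↦ h3 _ (hGS x y)⟩

end CStarNormedInnerProductModule

/-- **Corollary 4.3**: let `U, V` be adjointable isometries on a full Hilbert `A`-module `E`
with `U U* = V V* = id`.  Then the pair `(U, V)` is orthogonality preserving iff either
`U(E) ⊥ V(E)` or `U = γ V` for a unitary central multiplier `γ ∈ Z(M(A))` (where `γ` acts on
`A ⊴ M(A)` via `γ.fst`, and `U = γ V` is expressed via the inner products). -/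
theorem coisometry_pair_orthogonality_preserving_iff
    {A E : Type*} [NonUnitalCStarAlgebra A] [PartialOrder A] [StarOrderedRing A]
    [NormedAddCommGroup E] [Module ℂ E] [SMul A E] [CompleteSpace E]
    (ME : CStarNormedInnerProductModule A E) (hEfull : ME.IsFull)
    (U V U' V' : E → E)
    (hUadj : ∀ x y : E, ME.inner (U x) y = ME.inner x (U' y))
    (hVadj : ∀ x y : E, ME.inner (V x) y = ME.inner x (V' y))
    (hUiso : ∀ x y : E, ME.inner (U x) (U y) = ME.inner x y)
    (hViso : ∀ x y : E, ME.inner (V x) (V y) = ME.inner x y)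
    (hUcoiso : ∀ x : E, U (U' x) = x)
    (hVcoiso : ∀ x : E, V (V' x) = x) :
    (∀ x y : E, ME.inner x y = 0 → ME.inner (U x) (V y) = 0) ↔
      ((∀ x y : E, ME.inner (U x) (V y) = 0) ∨
        ∃ γ : 𝓜(ℂ, A), γ ∈ Set.center 𝓜(ℂ, A) ∧
          star γ * γ = 1 ∧ γ * star γ = 1 ∧
          ∀ x z : E, ME.inner (U x) z = γ.fst (ME.inner (V x) z)) := by
  constructor
  · intro h
    right
    have hV'adj (x y) : ME.inner (V' x) y = ME.inner x (V y) := by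
      rw [← ME.star_inner, ← hVadj, ME.star_inner]
    obtain ⟨γ, hγ, h1, h2, h3⟩ := ME.exists_unitary_mem_center_inner_map_eq hEfull
      (W := fun x ↦ V' (U x)) (W' := fun y ↦ U' (V y))
      (fun x y ↦ by rw [hV'adj, hUadj])
      (fun x y ↦ by rw [hV'adj, hVcoiso, hUiso])
      (fun x y hxy ↦ by rw [hV'adj, h x y hxy])
    refine ⟨γ, hγ, h1, h2, fun x z ↦ ?_⟩
    rw [hVadj, h3, hV'adj, hVcoiso]
  · rintro (h | ⟨γ, -, -, -, h⟩) x y hxy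
    · exact h x y
    · rw [h, hViso, hxy, map_zero]
end

section
/- Let A be a C*-algebra and let E be a full Hilbert A-module with inner product ⟨·,·⟩₁. Let ⟨·,·⟩₂ be another A-valued inner product on E whose induced norm is equivalent to the norm induced by ⟨·,·⟩₁. If ⟨x, y⟩₁ = 0 implies ⟨x, y⟩₂ = 0 for all x, y ∈ E, then there exists an invertible positive element γ ∈ Z(M(A)) such that ⟨x, y⟩₂ = γ·⟨x, y⟩₁ for all x, y ∈ E. -/
open MultiplierAlgebra

/-- An inner product module over a C*-algebra `A`: a (left) `A`-module `E` together with an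
`A`-valued inner product which is `ℂ`-linear and `A`-linear in the first variable, conjugate
symmetric, and positive definite. -/
structure CStarInnerProductModule (A E : Type*) [NonUnitalCStarAlgebra A]
    [PartialOrder A] [StarOrderedRing A]
    [AddCommGroup E] [Module ℂ E] [SMul A E] where
  inner : E → E → A
  add_left : ∀ x y z : E, inner (x + y) z = inner x z + inner y z
  smulC_left : ∀ (c : ℂ) (x y : E), inner (c • x) y = c • inner x y
  smulA_left : ∀ (a : A) (x y : E), inner (a • x) y = a * inner x y
  star_inner : ∀ x y : E, star (inner x y) = inner y x
  inner_self_nonneg : ∀ x : E, 0 ≤ inner x x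
  inner_self_eq_zero : ∀ x : E, inner x x = 0 ↔ x = 0
  smul_add : ∀ (a : A) (x y : E), a • (x + y) = a • x + a • y
  add_smul : ∀ (a b : A) (x : E), (a + b) • x = a • x + b • x
  mul_smul : ∀ (a b : A) (x : E), (a * b) • x = a • (b • x)
  smul_assoc : ∀ (c : ℂ) (a : A) (x : E), (c • a) • x = c • (a • x)

theorem commute_of_unitary_of_commute_commutator {B : Type*} [CStarAlgebra B] {u x : B}
    (hu : u ∈ unitary B) (h : u * (u * x - x * u) = (u * x - x * u) * u) : u * x = x * u := by
  set d := u * x - x * u with hd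
  have hpow : ∀ n : ℕ, u ^ (n + 1) * x - x * u ^ (n + 1) = (n + 1 : ℕ) • (u ^ n * d) := by
    intro n
    induction n with
    | zero => simp [hd]
    | succ n ih =>
      have hc : d * u ^ (n + 1) = u ^ (n + 1) * d :=
        ((show Commute u d from h).pow_left (n + 1)).eq.symm
      have : u ^ (n + 1 + 1) * x - x * u ^ (n + 1 + 1)
          = u * (u ^ (n + 1) * x - x * u ^ (n + 1)) + d * u ^ (n + 1) := by
        rw [hd, pow_succ' u (n + 1)]; noncomm_ring
      rw [this, ih, hc, succ_nsmul _ (n + 1), mul_smul_comm, ← mul_assoc, ← pow_succ']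
  have hbound : ∀ n : ℕ, (n + 1 : ℝ) * ‖d‖ ≤ 2 * ‖x‖ := by
    intro n
    have hun (m : ℕ) : u ^ m ∈ unitary B := pow_mem hu m
    have h1 : ‖u ^ (n + 1) * x - x * u ^ (n + 1)‖ ≤ 2 * ‖x‖ := by
      refine (norm_sub_le _ _).trans ?_
      rw [CStarRing.norm_mem_unitary_mul _ (hun _), CStarRing.norm_mul_mem_unitary _ (hun _)]
      linarith
    rw [hpow, ← Nat.cast_smul_eq_nsmul ℝ, norm_smul, CStarRing.norm_mem_unitary_mul _ (hun _)] at h1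
    rwa [Real.norm_natCast, Nat.cast_add_one] at h1
  have : ‖d‖ ≤ 0 := by
    by_contra! hpos
    obtain ⟨n, hn⟩ := exists_nat_gt (2 * ‖x‖ / ‖d‖)
    rw [div_lt_iff₀ hpos] at hn
    nlinarith [hbound n]
  exact sub_eq_zero.mp (norm_le_zero_iff.mp this)

theorem IsSelfAdjoint.commute_of_commute_commutator {B : Type*} [CStarAlgebra B] {b x : B}
    (hb : IsSelfAdjoint b) (h : b * (b * x - x * b) = (b * x - x * b) * b) : b * x = x * b := by
  have hunit : IsUnit (b + algebraMap ℂ B Complex.I) := by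
    by_contra hc
    have : -Complex.I ∈ spectrum ℂ b := by
      rw [spectrum.mem_iff, ← IsUnit.neg_iff]
      simpa [add_comm] using hc
    have := hb.im_eq_zero_of_mem_spectrum this
    simp at this
  obtain ⟨c, hc⟩ := hunit
  set i : B := algebraMap ℂ B Complex.I with hi
  have hib (y : B) : i * y = y * i := Algebra.commutes _ _
  have hii : i * i = -1 := by rw [hi, ← map_mul, Complex.I_mul_I]; simp
  have hsi : star i = -i := by rw [hi, ← algebraMap_star_comm]; simp
  set r : B := ↑c⁻¹ with hr
  have hrc : r * (b + i) = 1 := by rw [← hc]; simp [hr]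
  have hcr : (b + i) * r = 1 := by rw [← hc]; simp [hr]
  set d := b * x - x * b with hd
  have hbr : Commute b r := by
    have : Commute (c : B) b := by
      rw [hc]; exact (Commute.refl b).add_left (hib b)
    exact this.units_inv_left.symm
  have hdr : Commute d r := by
    have : Commute (c : B) d := by
      rw [hc]; exact (show Commute b d from h).add_left (hib d)
    exact this.units_inv_left.symm
  have hxr : r * x - x * r = - (r * d * r) := by
    have : r * d * r = r * ((b + i) * x - x * (b + i)) * r := by
      congr 2
      rw [hd, add_mul, mul_add, hib]; abel
    rw [this, mul_sub, sub_mul, ← mul_assoc, hrc, mul_assoc r (x * _), mul_assoc x, hcr]; simp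
  set u : B := (b - i) * r with hu
  have hur : u = 1 - 2 * i * r := by
    rw [← hcr, hu]; noncomm_ring
  have hstar : star r * (b - i) = 1 := by
    have := congrArg star hcr
    simpa [hsi, hb.star_eq, sub_eq_add_neg] using this
  have hstar' : (b - i) * star r = 1 := by
    have := congrArg star hrc
    simpa [hsi, hb.star_eq, sub_eq_add_neg] using this
  have hsu : star u = star r * (b + i) := by
    rw [hu, star_mul, star_sub, hsi, hb.star_eq, sub_neg_eq_add]
  have hcomm : (b + i) * (b - i) = (b - i) * (b + i) := by
    rw [add_mul, mul_sub, mul_sub, sub_mul, mul_add, mul_add, hib b]; abel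
  have huu : u ∈ unitary B := by
    rw [Unitary.mem_iff]
    constructor
    · rw [hsu, hu, mul_assoc, ← mul_assoc (b + i), hcomm, mul_assoc, hcr, mul_one, hstar]
    · have hbi : r * star r * ((b - i) * (b + i)) = 1 := by
        rw [mul_assoc, ← mul_assoc (star r), hstar, one_mul, hrc]
      have hbi' : (b - i) * (r * star r) * (b + i) = 1 := by
        have h1 : Commute (b - i) r := hbr.sub_left (hib r)
        rw [← mul_assoc, h1.eq, mul_assoc r, hstar', mul_one, hrc]
      rw [hsu, hu]
      simpa only [mul_assoc] using hbi'
  have hd' : u * x - x * u = 2 * i * (r * d * r) := by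
    have : u * x - x * u = -(2 * i * (r * x - x * r)) := by
      rw [hur, sub_mul, mul_sub, mul_sub, ← mul_assoc x (2 * i) r,
        ← (show Commute (2 * i) x from
          Commute.mul_left (Commute.ofNat_left 2 x) (hib x)).eq]
      noncomm_ring
    rw [this, hxr]; simp
  have hur' : Commute u (2 * i * (r * d * r)) := by
    have hir (y : B) : Commute (2 * i) y := Commute.mul_left (Commute.ofNat_left 2 y) (hib y)
    rw [hur]
    refine (Commute.one_left _).sub_left ((hir _).mul_left ?_)
    exact ((hir r).symm).mul_right
      (((Commute.refl r).mul_right hdr.symm).mul_right (Commute.refl r))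
  have key := commute_of_unitary_of_commute_commutator huu (x := x) (by rw [hd']; exact hur'.eq)
  rw [← sub_eq_zero, hd'] at key
  have hd0 : d = 0 := by
    have h1 : (b + i) * (i * (2 * i * (r * d * r))) * (b + i) = -(2 * d) := by
      have e1 : i * (2 * i * (r * d * r)) = -(2 * (r * d * r)) := by
        rw [← mul_assoc, ← mul_assoc i 2 i, (Commute.ofNat_right i 2).eq, mul_assoc 2 i i, hii]
        noncomm_ring
      have e2 : (b + i) * (r * d * r) * (b + i) = d := by
        rw [mul_assoc, mul_assoc (r * d), hrc, mul_one, ← mul_assoc, hcr, one_mul]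
      rw [e1, mul_neg, neg_mul, ← mul_assoc, (Commute.ofNat_right (b + i) 2).eq,
        mul_assoc 2, mul_assoc 2, e2]
    rw [key] at h1
    have h2 : (2 : ℂ) • d = 0 := by
      rw [two_smul, ← two_mul]; simpa using h1.symm
    simpa using h2
  exact sub_eq_zero.mp hd0

theorem intervalIntegral_max_sub_zero {t L : ℝ} (ht : 0 ≤ t) (htL : t ≤ L) :
    ∫ l in (0 : ℝ)..L, max (t - l) 0 = t ^ 2 / 2 := by
  have hc : Continuous fun l : ℝ => max (t - l) 0 := by fun_prop
  rw [← intervalIntegral.integral_add_adjacent_intervals (hc.intervalIntegrable 0 t)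
    (hc.intervalIntegrable t L)]
  have h1 : ∫ l in (0 : ℝ)..t, max (t - l) 0 = ∫ l in (0 : ℝ)..t, (t - l) := by
    refine intervalIntegral.integral_congr fun l hl => ?_
    rw [Set.uIcc_of_le ht] at hl
    exact max_eq_left (by linarith [hl.2])
  have h2 : ∫ l in t..L, max (t - l) 0 = ∫ l in t..L, (0 : ℝ) := by
    refine intervalIntegral.integral_congr fun l hl => ?_
    rw [Set.uIcc_of_le htL] at hl
    exact max_eq_right (by linarith [hl.1])
  rw [h1, h2, intervalIntegral.integral_sub (by simp) (by simp)]
  simp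
  ring

theorem intervalIntegral_mul_max_sub_zero {t L : ℝ} (ht : 0 ≤ t) (htL : t ≤ L) :
    ∫ l in (0 : ℝ)..L, l * max (t - l) 0 = t ^ 3 / 6 := by
  have hc : Continuous fun l : ℝ => l * max (t - l) 0 := by fun_prop
  rw [← intervalIntegral.integral_add_adjacent_intervals (hc.intervalIntegrable 0 t)
    (hc.intervalIntegrable t L)]
  have h1 : ∫ l in (0 : ℝ)..t, l * max (t - l) 0 = ∫ l in (0 : ℝ)..t, (t * l - l ^ 2) := by
    refine intervalIntegral.integral_congr fun l hl => ?_
    rw [Set.uIcc_of_le ht] at hl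
    simp only [max_eq_left (show 0 ≤ t - l by linarith [hl.2])]
    ring
  have h2 : ∫ l in t..L, l * max (t - l) 0 = ∫ l in t..L, (0 : ℝ) := by
    refine intervalIntegral.integral_congr fun l hl => ?_
    rw [Set.uIcc_of_le htL] at hl
    simp only [max_eq_right (show t - l ≤ 0 by linarith [hl.1]), mul_zero]
  rw [h1, h2, intervalIntegral.integral_sub (Continuous.intervalIntegrable (by fun_prop) _ _)
    (Continuous.intervalIntegrable (by fun_prop) _ _), intervalIntegral.integral_const_mul]
  simp
  ring

section

variable {A : Type*} [NonUnitalCStarAlgebra A]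

theorem IsSelfAdjoint.commute_of_triple_commutator {b s : A} (hb : IsSelfAdjoint b)
    (h : b * (b * (b * s)) - (3 : ℂ) • (b * (b * (s * b))) + (3 : ℂ) • (b * (s * (b * b)))
      - s * (b * (b * b)) = 0) : b * s = s * b := by
  have hb' : IsSelfAdjoint (b : Unitization ℂ A) := hb.inr ℂ
  have h' := congrArg (Unitization.inr : A → Unitization ℂ A) h
  simp only [Unitization.inr_sub, Unitization.inr_add, Unitization.inr_mul, Unitization.inr_smul,
    Unitization.inr_zero] at h'
  have e3 (y : Unitization ℂ A) : (3 : ℂ) • y = y + y + y := by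
    rw [show (3 : ℂ) = 1 + 1 + 1 by norm_num, add_smul, add_smul, one_smul]
  rw [e3, e3] at h'
  have h1 := hb'.commute_of_commute_commutator (x := b * (s : Unitization ℂ A) - s * b) (by
    rw [← sub_eq_zero, ← h']; noncomm_ring)
  have h2 := hb'.commute_of_commute_commutator h1
  rw [← Unitization.inr_mul, ← Unitization.inr_mul] at h2
  exact Unitization.inr_injective h2

variable [PartialOrder A] [StarOrderedRing A]

theorem commute_of_cfcₙ_max_sub {b s : A} (hb : 0 ≤ b)
    (h : ∀ l : ℝ, 0 ≤ l → ∀ p : A, p = cfcₙ (fun t : ℝ => max (t - l) 0) b →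
      l • (p * s - s * p) = p * s * b - b * s * p) : b * s = s * b := by
  have hsa : IsSelfAdjoint b := .of_nonneg hb
  set L := ‖b‖
  have hspec : ∀ t ∈ quasispectrum ℝ b, 0 ≤ t ∧ t ≤ L := fun t ht =>
    ⟨quasispectrum_nonneg_of_nonneg b hb t ht, (le_abs_self t).trans (by
      simpa [cfcₙ_id' ℝ b] using norm_apply_le_norm_cfcₙ (fun t : ℝ => t) b ht)⟩
  let μ := MeasureTheory.volume.restrict (Set.Icc (0 : ℝ) L)
  have hμ : ∀ᵐ l ∂μ, l ∈ Set.Icc (0 : ℝ) L := MeasureTheory.ae_restrict_mem measurableSet_Icc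
  have hL : 0 ≤ L := norm_nonneg _
  have hconv (f : ℝ → ℝ) : ∫ l, f l ∂μ = ∫ l in (0:ℝ)..L, f l := by
    rw [intervalIntegral.integral_of_le hL, MeasureTheory.integral_Icc_eq_integral_Ioc]
  have hfz : ∀ᵐ l ∂μ, max (0 - l) 0 = 0 := by
    filter_upwards [hμ] with l hl using max_eq_right (by linarith [hl.1])
  have hbd : ∀ᵐ l ∂μ, ∀ t ∈ quasispectrum ℝ b, ‖max (t - l) 0‖ ≤ L := by
    filter_upwards [hμ] with l hl t ht
    rw [Real.norm_of_nonneg (le_max_right _ _)]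
    exact max_le (by linarith [hl.1, (hspec t ht).2]) hL
  have hfz' : ∀ᵐ l ∂μ, l * max (0 - l) 0 = 0 := by
    filter_upwards [hfz] with l hl using by rw [hl, mul_zero]
  have hbd' : ∀ᵐ l ∂μ, ∀ t ∈ quasispectrum ℝ b, ‖l * max (t - l) 0‖ ≤ L * L := by
    filter_upwards [hμ, hbd] with l hl hl' t ht
    rw [norm_mul, Real.norm_of_nonneg hl.1]
    exact mul_le_mul hl.2 (hl' t ht) (norm_nonneg _) hL
  have hfin (c : ℝ) : MeasureTheory.HasFiniteIntegral (fun _ : ℝ => c) μ :=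
    (MeasureTheory.integrable_const c).2
  have hP := cfcₙ_integral (μ := μ) (fun l t : ℝ => max (t - l) 0) (fun _ => L) b
    (by unfold Function.uncurry; fun_prop) hfz hbd (hfin _)
  have hQ := cfcₙ_integral (μ := μ) (fun l t : ℝ => l * max (t - l) 0) (fun _ => L * L) b
    (by unfold Function.uncurry; fun_prop) hfz' hbd' (hfin _)
  have hPi := integrable_cfcₙ (μ := μ) (fun l t : ℝ => max (t - l) 0) (fun _ => L) b
    (by unfold Function.uncurry; fun_prop) hfz hbd (hfin _)
  have hQi := integrable_cfcₙ (μ := μ) (fun l t : ℝ => l * max (t - l) 0) (fun _ => L * L) b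
    (by unfold Function.uncurry; fun_prop) hfz' hbd' (hfin _)
  have hbb : cfcₙ (fun t : ℝ => t * t) b = b * b := by
    rw [cfcₙ_mul (fun t : ℝ => t) (fun t : ℝ => t) b, cfcₙ_id' ℝ b]
  have hbbb : cfcₙ (fun t : ℝ => t * (t * t)) b = b * (b * b) := by
    rw [cfcₙ_mul (fun t : ℝ => t) (fun t : ℝ => t * t) b, cfcₙ_id' ℝ b, hbb]
  have hP2 : cfcₙ (fun t : ℝ => ∫ l, max (t - l) 0 ∂μ) b = (1 / 2 : ℝ) • (b * b) := by
    rw [cfcₙ_congr (g := fun t : ℝ => (1 / 2 : ℝ) • (t * t)) fun t ht => by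
      simp only [hconv, intervalIntegral_max_sub_zero (hspec t ht).1 (hspec t ht).2, smul_eq_mul]
      ring]
    rw [cfcₙ_smul (1 / 2 : ℝ) (fun t : ℝ => t * t) b, hbb]
  have hQ3 : cfcₙ (fun t : ℝ => ∫ l, l * max (t - l) 0 ∂μ) b = (1 / 6 : ℝ) • (b * (b * b)) := by
    rw [cfcₙ_congr (g := fun t : ℝ => (1 / 6 : ℝ) • (t * (t * t))) fun t ht => by
      simp only [hconv, intervalIntegral_mul_max_sub_zero (hspec t ht).1 (hspec t ht).2,
        smul_eq_mul]
      ring]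
    rw [cfcₙ_smul (1 / 6 : ℝ) (fun t : ℝ => t * (t * t)) b, hbbb]
  let Φ : A →L[ℝ] A := (ContinuousLinearMap.mul ℝ A).flip (s * b) - ContinuousLinearMap.mul ℝ A (b * s)
  let Ψ : A →L[ℝ] A := (ContinuousLinearMap.mul ℝ A).flip s - ContinuousLinearMap.mul ℝ A s
  have hΦ (p : A) : Φ p = p * (s * b) - b * s * p := rfl
  have hΨ (p : A) : Ψ p = p * s - s * p := rfl
  have key : Ψ (∫ l, cfcₙ (fun t : ℝ => l * max (t - l) 0) b ∂μ)
      = Φ (∫ l, cfcₙ (fun t : ℝ => max (t - l) 0) b ∂μ) := by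
    rw [← ContinuousLinearMap.integral_comp_comm _ hPi,
      ← ContinuousLinearMap.integral_comp_comm _ hQi]
    refine MeasureTheory.integral_congr_ae ?_
    filter_upwards [hμ] with l hl
    have e : cfcₙ (fun t : ℝ => l * max (t - l) 0) b
        = l • cfcₙ (fun t : ℝ => max (t - l) 0) b := by
      rw [← cfcₙ_smul l (fun t : ℝ => max (t - l) 0) b (by fun_prop)
        (max_eq_right (by linarith [hl.1]))]
      rfl
    rw [e, map_smul, hΨ, hΦ, h l hl.1 _ rfl, mul_assoc]
  rw [← hP, ← hQ, hP2, hQ3, hΦ, hΨ] at key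
  refine hsa.commute_of_triple_commutator ?_
  have key' : (6 : ℝ) • ((1 / 6 : ℝ) • (b * (b * b)) * s - s * (1 / 6 : ℝ) • (b * (b * b))
      - ((1 / 2 : ℝ) • (b * b) * (s * b) - b * s * (1 / 2 : ℝ) • (b * b))) = 0 := by
    rw [key, sub_self, smul_zero]
  simp only [smul_sub, smul_mul_assoc, mul_smul_comm, smul_smul] at key'
  norm_num at key'
  have e3 (y : A) : (3 : ℂ) • y = (3 : ℝ) • y := by
    rw [← Complex.coe_smul]; norm_num
  rw [e3, e3, ← key']
  simp only [mul_assoc]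
  abel

end

/-- An `A`-valued form on `E` which is `ℂ`-linear and `A`-linear in the first variable, and
conjugate symmetric. -/
structure IsHermitianForm {A E : Type*} [NonUnitalCStarAlgebra A] [AddCommGroup E] [Module ℂ E]
    [SMul A E] (F : E → E → A) : Prop where
  add_left : ∀ x y z : E, F (x + y) z = F x z + F y z
  smulC_left : ∀ (c : ℂ) (x y : E), F (c • x) y = c • F x y
  smulA_left : ∀ (a : A) (x y : E), F (a • x) y = a * F x y
  star_apply : ∀ x y : E, star (F x y) = F y x

theorem CStarInnerProductModule.isHermitianForm {A E : Type*} [NonUnitalCStarAlgebra A]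
    [PartialOrder A] [StarOrderedRing A] [AddCommGroup E] [Module ℂ E] [SMul A E]
    (M : CStarInnerProductModule A E) : IsHermitianForm M.inner :=
  ⟨M.add_left, M.smulC_left, M.smulA_left, M.star_inner⟩

namespace IsHermitianForm

section Algebraic

variable {A E : Type*} [NonUnitalCStarAlgebra A] [AddCommGroup E] [Module ℂ E] [SMul A E]
  {F F₁ F₂ : E → E → A}

theorem add_right (hF : IsHermitianForm F) (x y z : E) : F x (y + z) = F x y + F x z := by
  rw [← hF.star_apply, hF.add_left, star_add, hF.star_apply, hF.star_apply]

theorem smulC_right (hF : IsHermitianForm F) (c : ℂ) (x y : E) :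
    F x (c • y) = star c • F x y := by
  rw [← hF.star_apply, hF.smulC_left, star_smul, hF.star_apply]

theorem smulA_right (hF : IsHermitianForm F) (a : A) (x y : E) :
    F x (a • y) = F x y * star a := by
  rw [← hF.star_apply, hF.smulA_left, star_mul, hF.star_apply]

theorem sub_left (hF : IsHermitianForm F) (x y z : E) : F (x - y) z = F x z - F y z := by
  rw [sub_eq_add_neg, ← neg_one_smul ℂ y, hF.add_left, hF.smulC_left, neg_one_smul, sub_eq_add_neg]

theorem sub_right (hF : IsHermitianForm F) (x y z : E) : F x (y - z) = F x y - F x z := by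
  rw [← hF.star_apply, hF.sub_left, star_sub, hF.star_apply, hF.star_apply]

theorem isSelfAdjoint (hF : IsHermitianForm F) (x : E) : IsSelfAdjoint (F x x) :=
  hF.star_apply x x

theorem smul_sub (h₁ : IsHermitianForm F₁) (h₂ : IsHermitianForm F₂) (K : ℝ) :
    IsHermitianForm fun x y => K • F₁ x y - F₂ x y where
  add_left x y z := by simp only [h₁.add_left, h₂.add_left, smul_add]; abel
  smulC_left c x y := by
    simp only [h₁.smulC_left, h₂.smulC_left, _root_.smul_sub, smul_comm K c]
  smulA_left a x y := by simp only [h₁.smulA_left, h₂.smulA_left, mul_sub, mul_smul_comm]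
  star_apply x y := by simp [h₁.star_apply, h₂.star_apply]

/-- Polarization, in the two inner variables, of an identity between products of forms. -/
theorem mul_eq_mul_of_diagonal (h₁ : IsHermitianForm F₁) (h₂ : IsHermitianForm F₂)
    (h : ∀ z w y, F₂ z w * F₁ w y = F₁ z w * F₂ w y) (z w x y : E) :
    F₂ z w * F₁ x y = F₁ z w * F₂ x y := by
  have e1 := h z (w + x) y
  have e2 := h z (w + Complex.I • x) y
  simp only [h₁.add_left, h₁.add_right, h₂.add_left, h₂.add_right, h₁.smulC_left,
    h₁.smulC_right, h₂.smulC_left, h₂.smulC_right, add_mul, mul_add, smul_mul_assoc,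
    mul_smul_comm, h z w y, h z x y] at e1 e2
  rw [← sub_eq_zero] at e1 e2 ⊢
  have hI : star Complex.I = -Complex.I := Complex.conj_I
  rw [hI] at e2
  have e3 : (2 * Complex.I) • (F₂ z w * F₁ x y - F₁ z w * F₂ x y) = 0 := by
    rw [show (0 : A) = Complex.I • (0 : A) + 0 by simp]
    nth_rewrite 1 [← e1]
    rw [← e2]
    module
  simpa using e3

end Algebraic

section Norm

variable {A E : Type*} [NonUnitalCStarAlgebra A] [NormedAddCommGroup E] [NormedSpace ℂ E]
  [SMul A E] {F F₁ F₂ : E → E → A}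

theorem norm_apply_le (hF : IsHermitianForm F) {K : ℝ} (hK : ∀ x, ‖F x x‖ ≤ K * ‖x‖ ^ 2)
    (x y : E) : ‖F x y‖ ≤ 4 * K * ‖x‖ * ‖y‖ := by
  have unit (x y : E) (hx : ‖x‖ = 1) (hy : ‖y‖ = 1) : ‖F x y‖ ≤ 4 * K := by
    have hK0 : 0 ≤ K := by simpa [hx] using (norm_nonneg _).trans (hK x)
    have hpol : (4 : ℂ) • F x y = F (x + y) (x + y) - F (x - y) (x - y)
        + Complex.I • F (x + Complex.I • y) (x + Complex.I • y)
        - Complex.I • F (x - Complex.I • y) (x - Complex.I • y) := by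
      have hI : star Complex.I = -Complex.I := Complex.conj_I
      simp only [hF.add_left, hF.add_right, hF.sub_left, hF.sub_right, hF.smulC_left,
        hF.smulC_right, hI, smul_add, _root_.smul_sub, smul_smul, Complex.I_mul_I,
        neg_neg, one_smul, neg_smul]
      match_scalars <;> ring_nf
      simp
      norm_num
    have hb (v : E) (hv : ‖v‖ ≤ 2) : ‖F v v‖ ≤ 4 * K := by
      have h1 := hK v
      have : ‖v‖ ^ 2 ≤ 4 := by nlinarith [norm_nonneg v]
      nlinarith
    have hIy : ‖Complex.I • y‖ = 1 := by rw [norm_smul, Complex.norm_I, hy, one_mul]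
    have b1 := hb (x + y) ((norm_add_le _ _).trans (by linarith))
    have b2 := hb (x - y) ((norm_sub_le _ _).trans (by linarith))
    have b3 := hb (x + Complex.I • y) ((norm_add_le _ _).trans (by linarith))
    have b4 := hb (x - Complex.I • y) ((norm_sub_le _ _).trans (by linarith))
    have h4 : ‖(4 : ℂ) • F x y‖ = 4 * ‖F x y‖ := by rw [norm_smul]; simp
    have := congrArg norm hpol
    rw [h4] at this
    have t := (norm_sub_le (F (x + y) (x + y) - F (x - y) (x - y)
        + Complex.I • F (x + Complex.I • y) (x + Complex.I • y))
        (Complex.I • F (x - Complex.I • y) (x - Complex.I • y)))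
    have t2 := norm_add_le (F (x + y) (x + y) - F (x - y) (x - y))
        (Complex.I • F (x + Complex.I • y) (x + Complex.I • y))
    have t3 := norm_sub_le (F (x + y) (x + y)) (F (x - y) (x - y))
    simp only [norm_smul, Complex.norm_I, one_mul] at t t2
    linarith
  rcases eq_or_ne x 0 with rfl | hx
  · have : F 0 y = 0 := by rw [← zero_smul ℂ (0 : E), hF.smulC_left, zero_smul]
    simp [this]
  rcases eq_or_ne y 0 with rfl | hy
  · have : F x 0 = 0 := by rw [← zero_smul ℂ (0 : E), hF.smulC_right, star_zero, zero_smul]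
    simp [this]
  have hx' : 0 < ‖x‖ := norm_pos_iff.mpr hx
  have hy' : 0 < ‖y‖ := norm_pos_iff.mpr hy
  have := unit ((‖x‖⁻¹ : ℂ) • x) ((‖y‖⁻¹ : ℂ) • y) (by rw [norm_smul]; simp [hx'.ne'])
    (by rw [norm_smul]; simp [hy'.ne'])
  rw [hF.smulC_left, hF.smulC_right, norm_smul, norm_smul, norm_star] at this
  simp only [norm_inv, Complex.norm_real, norm_norm] at this
  rw [← mul_assoc, ← mul_inv, inv_mul_le_iff₀ (by positivity)] at this
  linarith

theorem tendsto_apply (hF : IsHermitianForm F) {K : ℝ} (hK : ∀ x, ‖F x x‖ ≤ K * ‖x‖ ^ 2)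
    {ι : Type*} {l : Filter ι} {f g : ι → E} {x y : E} (hf : Filter.Tendsto f l (nhds x))
    (hg : Filter.Tendsto g l (nhds y)) :
    Filter.Tendsto (fun i => F (f i) (g i)) l (nhds (F x y)) := by
  rw [tendsto_iff_norm_sub_tendsto_zero]
  have hb (i : ι) : ‖F (f i) (g i) - F x y‖
      ≤ 4 * K * ‖f i - x‖ * ‖g i‖ + 4 * K * ‖x‖ * ‖g i - y‖ := by
    have : F (f i) (g i) - F x y = F (f i - x) (g i) + F x (g i - y) := by
      rw [hF.sub_left, hF.sub_right]; abel
    rw [this]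
    exact (norm_add_le _ _).trans (add_le_add (hF.norm_apply_le hK _ _) (hF.norm_apply_le hK _ _))
  refine squeeze_zero (fun _ => norm_nonneg _) hb ?_
  rw [tendsto_iff_norm_sub_tendsto_zero] at hf
  have h1 := ((hf.const_mul (4 * K)).mul hg.norm)
  rw [tendsto_iff_norm_sub_tendsto_zero] at hg
  simpa using h1.add (hg.const_mul (4 * K * ‖x‖))

theorem exists_continuousLinearMap (h₁ : IsHermitianForm F₁) (h₂ : IsHermitianForm F₂)
    (hfull : (Submodule.span ℂ {a : A | ∃ x y : E, a = F₁ x y}).topologicalClosure = ⊤)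
    {κ : ℝ} (hκ0 : 0 ≤ κ)
    (hb : ∀ (s : Finset (E × E)) (x y : E × E → E),
      ‖∑ i ∈ s, F₂ (x i) (y i)‖ ≤ κ * ‖∑ i ∈ s, F₁ (x i) (y i)‖) :
    ∃ T : A →L[ℂ] A, ‖T‖ ≤ κ ∧ (∀ x y, T (F₁ x y) = F₂ x y) ∧
      (∀ a c, T (a * c) = a * T c) ∧ (∀ a c, T (a * c) = T a * c) ∧
      ∀ a, star (T (star a)) = T a := by
  have hdense : Dense (Submodule.span ℂ {a : A | ∃ x y : E, a = F₁ x y} : Set A) :=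
    Submodule.dense_iff_topologicalClosure_eq_top.mpr hfull
  have hrange : {a : A | ∃ x y : E, a = F₁ x y} = Set.range fun p : E × E => F₁ p.1 p.2 := by
    ext a
    simp [eq_comm]
  have hdr : DenseRange (Finsupp.linearCombination ℂ fun p : E × E => F₁ p.1 p.2) := by
    rw [hrange] at hdense
    rwa [DenseRange, ← LinearMap.coe_range, Finsupp.range_linearCombination]
  have hle (f : E × E →₀ ℂ) : ‖Finsupp.linearCombination ℂ (fun p : E × E => F₂ p.1 p.2) f‖
      ≤ κ * ‖Finsupp.linearCombination ℂ (fun p : E × E => F₁ p.1 p.2) f‖ := by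
    simpa only [Finsupp.linearCombination_apply, Finsupp.sum, h₁.smulC_left, h₂.smulC_left]
      using hb f.support (fun p => f p • p.1) (fun p => p.2)
  obtain ⟨T, hT⟩ : ∃ T, T = (Finsupp.linearCombination ℂ fun p : E × E => F₂ p.1 p.2).extendOfNorm
    (Finsupp.linearCombination ℂ fun p : E × E => F₁ p.1 p.2) := ⟨_, rfl⟩
  have hTF (x y : E) : T (F₁ x y) = F₂ x y := by
    have := LinearMap.extendOfNorm_eq hdr ⟨κ, hle⟩ (Finsupp.single (x, y) 1)
    simpa [hT] using this
  refine ⟨T, hT ▸ LinearMap.opNorm_extendOfNorm_le hdr hκ0 hle, hTF, fun a c => ?_, fun a c => ?_,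
    fun a => ?_⟩
  · have : T ∘L ContinuousLinearMap.mul ℂ A a = ContinuousLinearMap.mul ℂ A a ∘L T := by
      refine ContinuousLinearMap.ext_on hdense ?_
      rintro _ ⟨x, y, rfl⟩
      simp [← h₁.smulA_left, hTF, h₂.smulA_left]
    exact DFunLike.congr_fun this c
  · have : T ∘L (ContinuousLinearMap.mul ℂ A).flip c
        = (ContinuousLinearMap.mul ℂ A).flip c ∘L T := by
      refine ContinuousLinearMap.ext_on hdense ?_
      rintro _ ⟨x, y, rfl⟩
      have e1 := h₁.smulA_right (star c) x y
      have e2 := h₂.smulA_right (star c) x y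
      rw [star_star] at e1 e2
      simp [← e1, hTF, e2]
    exact DFunLike.congr_fun this a
  · have : ((starL ℂ (A := A)).toContinuousLinearMap.comp T).comp
        (starL ℂ (A := A)).toContinuousLinearMap = T := by
      refine ContinuousLinearMap.ext_on hdense ?_
      rintro _ ⟨x, y, rfl⟩
      simp [h₁.star_apply, hTF, h₂.star_apply]
    exact DFunLike.congr_fun this a

variable [PartialOrder A] [StarOrderedRing A]

theorem norm_apply_sub_cfcₙ_smul_le (hF : IsHermitianForm F) (hpos : ∀ x, 0 ≤ F x x) {h : A}
    {x : E} (hx : F x x ≤ h) {f : ℝ → ℝ} (hf : Continuous f) (hf0 : f 0 = 0) {η : ℝ}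
    (hη : ∀ t, 0 ≤ t → t * (1 - f t) ^ 2 ≤ η) :
    ‖F (x - cfcₙ f h • x) (x - cfcₙ f h • x)‖ ≤ η := by
  have hh : 0 ≤ h := (hpos x).trans hx
  have hsa : IsSelfAdjoint h := .of_nonneg hh
  have hu : star (cfcₙ f h) = cfcₙ f h := (cfcₙ_predicate f h : IsSelfAdjoint _).star_eq
  have hcfc : cfcₙ (fun t : ℝ => t - f t * t - t * f t + f t * t * f t) h
      = h - cfcₙ f h * h - h * cfcₙ f h + cfcₙ f h * h * cfcₙ f h := by
    have h1 : cfcₙ (fun t : ℝ => f t * t) h = cfcₙ f h * h := by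
      rw [cfcₙ_mul f (fun t : ℝ => t) h, cfcₙ_id' ℝ h]
    have h2 : cfcₙ (fun t : ℝ => t * f t) h = h * cfcₙ f h := by
      rw [cfcₙ_mul (fun t : ℝ => t) f h, cfcₙ_id' ℝ h]
    rw [cfcₙ_add (fun t : ℝ => t - f t * t - t * f t) (fun t => f t * t * f t) h,
      cfcₙ_sub (fun t : ℝ => t - f t * t) (fun t => t * f t) h,
      cfcₙ_sub (fun t : ℝ => t) (fun t => f t * t) h,
      cfcₙ_mul (fun t : ℝ => f t * t) f h, h1, h2, cfcₙ_id' ℝ h]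
  set u := cfcₙ f h
  have hle : F (x - u • x) (x - u • x) ≤ h - u * h - h * u + u * h * u := by
    obtain ⟨r, hr⟩ := CStarAlgebra.nonneg_iff_eq_star_mul_self.mp (sub_nonneg.mpr hx)
    have h2 : h - u * h - h * u + u * h * u - F (x - u • x) (x - u • x)
        = star (r - r * u) * (r - r * u) := by
      have : star (r - r * u) * (r - r * u) = (h - F x x) - u * (h - F x x) - (h - F x x) * u
          + u * (h - F x x) * u := by
        rw [hr, star_sub, star_mul, hu]; noncomm_ring
      rw [this, hF.sub_left, hF.sub_right, hF.sub_right, hF.smulA_left, hF.smulA_left,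
        hF.smulA_right, hu]
      noncomm_ring
    rw [← sub_nonneg, h2]
    exact star_mul_self_nonneg _
  refine (CStarAlgebra.norm_le_norm_of_nonneg_of_le (hpos _) hle).trans ?_
  rw [← hcfc]
  refine norm_cfcₙ_le fun t ht => ?_
  have ht0 := quasispectrum_nonneg_of_nonneg h hh t ht
  have e : t - f t * t - t * f t + f t * t * f t = t * (1 - f t) ^ 2 := by ring
  rw [e, Real.norm_of_nonneg (by positivity)]
  exact hη t ht0

theorem tendsto_cfcₙ_smul (hF : IsHermitianForm F) (hpos : ∀ x, 0 ≤ F x x) {K : ℝ}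
    (hK : ∀ x, ‖x‖ ^ 2 ≤ K * ‖F x x‖) {h : A} {x : E} (hx : F x x ≤ h) {f : ℝ → ℝ → ℝ}
    (hf : ∀ l, 0 < l → Continuous (f l)) (hf0 : ∀ l, 0 < l → f l 0 = 0) {C : ℝ}
    (hC : ∀ l, 0 < l → ∀ t, 0 ≤ t → t * (1 - f l t) ^ 2 ≤ C * l) :
    Filter.Tendsto (fun l => cfcₙ (f l) h • x) (nhdsWithin 0 (Set.Ioi 0)) (nhds x) := by
  have hb : ∀ᶠ l in nhdsWithin (0 : ℝ) (Set.Ioi 0),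
      ‖x - cfcₙ (f l) h • x‖ ≤ √(|K| * (C * l)) := by
    filter_upwards [self_mem_nhdsWithin] with l hl
    refine Real.le_sqrt_of_sq_le ((hK _).trans ?_)
    exact (mul_le_mul_of_nonneg_right (le_abs_self K) (norm_nonneg _)).trans
      (mul_le_mul_of_nonneg_left
        (hF.norm_apply_sub_cfcₙ_smul_le hpos hx (hf l hl) (hf0 l hl) (hC l hl)) (abs_nonneg K))
  have hlim : Filter.Tendsto (fun l : ℝ => √(|K| * (C * l))) (nhdsWithin 0 (Set.Ioi 0))
      (nhds 0) := by
    have : Continuous fun l : ℝ => √(|K| * (C * l)) := by fun_prop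
    simpa using (this.tendsto 0).mono_left nhdsWithin_le_nhds
  rw [tendsto_iff_norm_sub_tendsto_zero]
  refine squeeze_zero' (.of_forall fun _ => norm_nonneg _) ?_ hlim
  filter_upwards [hb] with l hl
  rwa [norm_sub_rev]

theorem sqrt_mul_sqrt_div_max {l t : ℝ} (ht : 0 ≤ t) : √t * (√t / max t l) = t / max t l := by
  rw [← mul_div_assoc, Real.mul_self_sqrt ht]

theorem mul_one_sub_div_max_sq_le {l t : ℝ} (hl : 0 < l) (ht : 0 ≤ t) :
    t * (1 - t / max t l) ^ 2 ≤ 1 * l := by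
  rcases le_total l t with h | h
  · rw [max_eq_left h, div_self (hl.trans_le h).ne']
    simpa using hl.le
  · rw [max_eq_right h]
    have h0 : 0 ≤ t / l := by positivity
    have h1 : t / l ≤ 1 := (div_le_one hl).mpr h
    have : (1 - t / l) ^ 2 ≤ 1 := by nlinarith
    nlinarith [sq_nonneg (1 - t / l)]

theorem mul_one_sub_div_max_sq_sq_le {l t : ℝ} (hl : 0 < l) (ht : 0 ≤ t) :
    t * (1 - (t / max t l) ^ 2) ^ 2 ≤ 1 * l := by
  rcases le_total l t with h | h
  · rw [max_eq_left h, div_self (hl.trans_le h).ne']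
    simpa using hl.le
  · rw [max_eq_right h]
    have h0 : 0 ≤ (t / l) ^ 2 := by positivity
    have h1 : (t / l) ^ 2 ≤ 1 := pow_le_one₀ (by positivity) ((div_le_one hl).mpr h)
    have : (1 - (t / l) ^ 2) ^ 2 ≤ 1 := by nlinarith
    nlinarith [sq_nonneg (1 - (t / l) ^ 2)]

theorem mul_one_sub_ramp_sq_le {l t : ℝ} (hl : 0 < l) :
    t * (1 - min 1 (max 0 (t / l - 1))) ^ 2 ≤ 2 * l := by
  rcases le_total (2 * l) t with h | h
  · have : 2 ≤ t / l := (le_div_iff₀ hl).mpr h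
    rw [min_eq_left (le_max_of_le_right (by linarith))]
    simpa using hl.le
  · have h0 : 0 ≤ min 1 (max 0 (t / l - 1)) := le_min zero_le_one (le_max_left _ _)
    have h1 : min 1 (max 0 (t / l - 1)) ≤ 1 := min_le_left _ _
    have : (1 - min 1 (max 0 (t / l - 1))) ^ 2 ≤ 1 := by nlinarith
    nlinarith [sq_nonneg (1 - min 1 (max 0 (t / l - 1)))]

theorem mul_ramp_eq {l t : ℝ} (hl : 0 < l) :
    t / max t l ^ 2 * (t * min 1 (max 0 (t / l - 1))) = min 1 (max 0 (t / l - 1)) := by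
  rcases le_total l t with h | h
  · have : 0 < t := hl.trans_le h
    rw [max_eq_left h]
    field_simp
  · have : t / l ≤ 1 := (div_le_one hl).mpr h
    rw [max_eq_left (show t / l - 1 ≤ 0 by linarith)]
    simp

theorem continuous_div_max {f : ℝ → ℝ} (hf : Continuous f) {l : ℝ} (hl : 0 < l) (n : ℕ) :
    Continuous fun t => f t / max t l ^ n :=
  hf.div (by fun_prop) fun t => (pow_pos (hl.trans_le (le_max_right t l)) n).ne'

theorem commute_of_orthogonality (h₁ : IsHermitianForm F₁) (h₂ : IsHermitianForm F₂)
    (h : ∀ x y, F₁ x y = 0 → F₂ x y = 0) {w : E} (hw : 0 ≤ F₁ w w) :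
    F₁ w w * F₂ w w = F₂ w w * F₁ w w := by
  refine commute_of_cfcₙ_max_sub hw fun l hl p hp => ?_
  have hpsa : star p = p := by
    rw [hp]; exact (cfcₙ_predicate _ _ : IsSelfAdjoint _).star_eq
  have hsa : IsSelfAdjoint (F₁ w w) := h₁.isSelfAdjoint w
  have hsa₂ := h₂.isSelfAdjoint w
  have hbsa := hsa.star_eq
  have hzero : p * F₁ w w * p - p * F₁ w w * F₁ w w + l • (p * F₁ w w) = 0 := by
    have hc : Continuous fun t : ℝ => max (t - l) 0 := by fun_prop
    have h0 : max (0 - l) 0 = 0 := max_eq_right (by linarith)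
    have hid : cfcₙ (fun t : ℝ => t) (F₁ w w) = F₁ w w := cfcₙ_id' ℝ _
    have e1 : cfcₙ (fun t : ℝ => max (t - l) 0 * t) (F₁ w w) = p * F₁ w w := by
      rw [cfcₙ_mul (fun t : ℝ => max (t - l) 0) (fun t => t) (F₁ w w) hc.continuousOn h0, hid, hp]
    have c1 : ContinuousOn (fun t : ℝ => max (t - l) 0 * t) (quasispectrum ℝ (F₁ w w)) := by
      fun_prop
    have e2 : cfcₙ (fun t : ℝ => max (t - l) 0 * t * max (t - l) 0) (F₁ w w)
        = p * F₁ w w * p := by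
      rw [cfcₙ_mul (fun t : ℝ => max (t - l) 0 * t) (fun t => max (t - l) 0) (F₁ w w) c1
        (by simp) hc.continuousOn h0, e1, ← hp]
    have e3 : cfcₙ (fun t : ℝ => max (t - l) 0 * t * t) (F₁ w w)
        = p * F₁ w w * F₁ w w := by
      rw [cfcₙ_mul (fun t : ℝ => max (t - l) 0 * t) (fun t => t) (F₁ w w) c1
        (by simp), e1, hid]
    rw [← e2, ← e3, ← e1, ← cfcₙ_smul l (fun t : ℝ => max (t - l) 0 * t) (F₁ w w) c1 (by simp),
      ← cfcₙ_sub (fun t : ℝ => max (t - l) 0 * t * max (t - l) 0)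
        (fun t : ℝ => max (t - l) 0 * t * t) (F₁ w w) (by fun_prop) (by simp) (by fun_prop)
        (by simp),
      ← cfcₙ_add (fun t : ℝ => max (t - l) 0 * t * max (t - l) 0 - max (t - l) 0 * t * t)
        (fun t : ℝ => l • (max (t - l) 0 * t)) (F₁ w w) (by fun_prop) (by simp) (by fun_prop)
        (by simp)]
    have : (fun t : ℝ => max (t - l) 0 * t * max (t - l) 0 - max (t - l) 0 * t * t
        + l • (max (t - l) 0 * t)) = fun _ => 0 := by
      funext t
      rcases max_cases (t - l) 0 with ⟨e, -⟩ | ⟨e, -⟩ <;> rw [e, smul_eq_mul] <;> ring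
    rw [this]
    exact cfcₙ_const_zero ℝ _
  have expand (F : E → E → A) (hF : IsHermitianForm F) :
      F (p • w) (p • w - F₁ w w • w + (l : ℂ) • w)
        = p * F w w * p - p * F w w * F₁ w w + l • (p * F w w) := by
    rw [hF.add_right, hF.sub_right, hF.smulC_right, hF.smulA_left, hF.smulA_left, hF.smulA_right,
      hF.smulA_right, hpsa, hbsa]
    have : star (l : ℂ) = l := Complex.conj_ofReal l
    rw [this, hF.smulA_left, Complex.coe_smul, mul_assoc, mul_assoc]
  have e := h _ _ ((expand F₁ h₁).trans hzero)
  rw [expand F₂ h₂] at e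
  have e' := congrArg star e
  simp only [star_add, star_sub, star_mul, star_smul, hpsa, hbsa, hsa₂.star_eq, star_zero,
    star_trivial] at e'
  rw [_root_.smul_sub]
  have e3 := e.trans e'.symm
  simp only [mul_assoc] at e3 ⊢
  have : l • (p * F₂ w w) - l • (F₂ w w * p)
      = (p * (F₂ w w * p) - p * (F₂ w w * F₁ w w) + l • (p * F₂ w w))
        - (p * (F₂ w w * p) - F₁ w w * (F₂ w w * p) + l • (F₂ w w * p))
        + p * (F₂ w w * F₁ w w) - F₁ w w * (F₂ w w * p) := by abel
  rw [this, e3, sub_self, zero_add]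

theorem mul_eq_mul_of_orthogonality (h₁ : IsHermitianForm F₁) (h₂ : IsHermitianForm F₂)
    (hpos : ∀ x, 0 ≤ F₁ x x) (hn : ∀ x, ‖x‖ ^ 2 = ‖F₁ x x‖) {K : ℝ}
    (hK : ∀ x, ‖F₂ x x‖ ≤ K * ‖x‖ ^ 2) (h : ∀ x y, F₁ x y = 0 → F₂ x y = 0) (z w x y : E) :
    F₂ z w * F₁ x y = F₁ z w * F₂ x y := by
  refine mul_eq_mul_of_diagonal h₁ h₂ (fun z w y => ?_) z w x y
  have hcomm : Commute (F₁ w w) (F₂ w w) := commute_of_orthogonality h₁ h₂ h (hpos w)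
  have hsa : IsSelfAdjoint (F₁ w w) := h₁.isSelfAdjoint w
  have main (l : ℝ) (hl : 0 < l) (u : A)
      (hu : u = cfcₙ (fun t : ℝ => min 1 (max 0 (t / l - 1))) (F₁ w w)) :
      F₂ z w * F₁ (u • w) y = F₁ z w * F₂ (u • w) y := by
    have hcg : Continuous fun t : ℝ => min 1 (max 0 (t / l - 1)) := by fun_prop
    have hg0 : min 1 (max 0 (0 / l - 1)) = 0 := by simp
    have hck : Continuous fun t : ℝ => t / max t l ^ 2 := continuous_div_max continuous_id hl 2
    obtain ⟨k, hk⟩ : ∃ k, k = cfcₙ (fun t : ℝ => t / max t l ^ 2) (F₁ w w) := ⟨_, rfl⟩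
    have hkg : k * (F₁ w w * u) = u := by
      rw [hk, hu]
      nth_rewrite 2 [← cfcₙ_id' ℝ (F₁ w w)]
      rw [← cfcₙ_mul (fun t : ℝ => t) _ (F₁ w w) (by fun_prop) rfl hcg.continuousOn hg0,
        ← cfcₙ_mul (fun t : ℝ => t / max t l ^ 2) (fun t => t * min 1 (max 0 (t / l - 1)))
          (F₁ w w) hck.continuousOn (by simp) (by fun_prop) (by simp)]
      exact cfcₙ_congr fun t _ => mul_ramp_eq hl
    have hus : star u = u := by rw [hu]; exact (cfcₙ_predicate _ _ : IsSelfAdjoint _).star_eq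
    have hks : star k = k := by rw [hk]; exact (cfcₙ_predicate _ _ : IsSelfAdjoint _).star_eq
    have huc : Commute u (F₂ w w) := by rw [hu]; exact hcomm.cfcₙ_real _
    have hkc : Commute k (F₂ w w) := by rw [hk]; exact hcomm.cfcₙ_real _
    have huk : Commute u k := by rw [hu, hk]; exact cfcₙ_commute_cfcₙ _ _ _
    have hproj (v : E) : F₂ v w * u = F₁ v w * (k * (F₂ w w * u)) := by
      have e := h (v - (F₁ v w * k) • w) (u • w) (by
        rw [h₁.sub_left, h₁.smulA_left, h₁.smulA_right, h₁.smulA_right, hus, mul_assoc, hkg,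
          sub_self])
      rw [h₂.sub_left, h₂.smulA_left, h₂.smulA_right, h₂.smulA_right, hus, mul_assoc] at e
      exact sub_eq_zero.mp e
    have hproj' : u * F₂ w y = u * F₂ w w * k * F₁ w y := by
      have e := congrArg star (hproj y)
      simpa only [star_mul, h₁.star_apply, h₂.star_apply, hus, hks, mul_assoc] using e
    have hswap : k * (F₂ w w * u) = u * F₂ w w * k := by
      rw [← huc.eq, ← mul_assoc, ← huk.eq, mul_assoc, hkc.eq, mul_assoc]
    rw [h₁.smulA_left, h₂.smulA_left, ← mul_assoc, hproj, hproj', hswap, mul_assoc]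
  have hlim := h₁.tendsto_cfcₙ_smul hpos (K := 1) (fun x => by rw [hn, one_mul]) (le_refl (F₁ w w))
    (f := fun l t : ℝ => min 1 (max 0 (t / l - 1))) (fun l _ => by fun_prop)
    (fun l _ => by simp) (fun l hl t _ => mul_one_sub_ramp_sq_le hl)
  have l1 := (h₁.tendsto_apply (K := 1) (fun x => by rw [hn, one_mul]) hlim
    (tendsto_const_nhds (x := y))).const_mul (F₂ z w)
  have l2 := (h₂.tendsto_apply hK hlim (tendsto_const_nhds (x := y))).const_mul (F₁ z w)
  refine tendsto_nhds_unique_of_eventuallyEq l1 l2 ?_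
  filter_upwards [self_mem_nhdsWithin] with l hl using main l hl _ rfl

theorem norm_cfcₙ_conj_le {b : A} (hb : 0 ≤ b) {l : ℝ} (hl : 0 < l) :
    ‖cfcₙ (fun t : ℝ => √t / max t l) b * b * cfcₙ (fun t : ℝ => √t / max t l) b‖ ≤ 1 := by
  have hsa : IsSelfAdjoint b := .of_nonneg hb
  have hc : Continuous fun t : ℝ => √t / max t l := by
    simpa using continuous_div_max Real.continuous_sqrt hl 1
  have e : cfcₙ (fun t : ℝ => √t / max t l * t) b = cfcₙ (fun t : ℝ => √t / max t l) b * b := by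
    rw [cfcₙ_mul (fun t : ℝ => √t / max t l) (fun t => t) b (hf := hc.continuousOn), cfcₙ_id' ℝ b]
  rw [← e, ← cfcₙ_mul (fun t : ℝ => √t / max t l * t) (fun t : ℝ => √t / max t l) b
    (hf := (hc.mul continuous_id).continuousOn) (hg := hc.continuousOn)]
  refine norm_cfcₙ_le fun t ht => ?_
  have ht0 := quasispectrum_nonneg_of_nonneg b hb t ht
  have hm : 0 < max t l := hl.trans_le (le_max_right _ _)
  have e2 : √t / max t l * t * (√t / max t l) = (t / max t l) ^ 2 := by
    calc √t / max t l * t * (√t / max t l) = (√t * √t) * t / max t l ^ 2 := by ring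
      _ = _ := by rw [Real.mul_self_sqrt ht0]; ring
  rw [e2, Real.norm_of_nonneg (by positivity)]
  exact pow_le_one₀ (by positivity) ((div_le_one hm).mpr (le_max_left _ _))

/-- A norm inequality between the diagonals of two positive forms is an order inequality. -/
theorem apply_self_le_smul (h₁ : IsHermitianForm F₁) (h₂ : IsHermitianForm F₂)
    (hpos₁ : ∀ x, 0 ≤ F₁ x x) {K₁ K₂ K : ℝ} (hK₁ : ∀ x, ‖x‖ ^ 2 ≤ K₁ * ‖F₁ x x‖)
    (hK₂ : ∀ x, ‖F₂ x x‖ ≤ K₂ * ‖x‖ ^ 2) (hK0 : 0 ≤ K) (hK : ∀ x, ‖F₂ x x‖ ≤ K * ‖F₁ x x‖)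
    (w : E) : F₂ w w ≤ K • F₁ w w := by
  have hsa : IsSelfAdjoint (F₁ w w) := h₁.isSelfAdjoint w
  have hlim := h₁.tendsto_cfcₙ_smul hpos₁ hK₁ (le_refl (F₁ w w))
    (f := fun l t : ℝ => t / max t l)
    (fun l hl => by simpa using continuous_div_max continuous_id hl 1)
    (fun l _ => by simp) (fun l hl t ht => mul_one_sub_div_max_sq_le hl ht)
  refine le_of_tendsto (h₂.tendsto_apply hK₂ hlim hlim) ?_
  filter_upwards [self_mem_nhdsWithin] with l hl
  have hc : Continuous fun t : ℝ => √t / max t l := by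
    simpa using continuous_div_max Real.continuous_sqrt hl 1
  obtain ⟨v, hv⟩ : ∃ v, v = cfcₙ (fun t : ℝ => √t / max t l) (F₁ w w) := ⟨_, rfl⟩
  obtain ⟨r, hr⟩ : ∃ r, r = cfcₙ (fun t : ℝ => √t) (F₁ w w) := ⟨_, rfl⟩
  have hvs : star v = v := by rw [hv]; exact (cfcₙ_predicate _ _ : IsSelfAdjoint _).star_eq
  have hrs : star r = r := by rw [hr]; exact (cfcₙ_predicate _ _ : IsSelfAdjoint _).star_eq
  have hrr : r * r = F₁ w w := by
    rw [hr, ← cfcₙ_mul (fun t : ℝ => √t) (fun t : ℝ => √t) (F₁ w w)]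
    nth_rewrite 2 [← cfcₙ_id' ℝ (F₁ w w)]
    exact cfcₙ_congr fun t ht =>
      Real.mul_self_sqrt (quasispectrum_nonneg_of_nonneg _ (hpos₁ w) t ht)
  have hrv : cfcₙ (fun t : ℝ => t / max t l) (F₁ w w) = r * v := by
    rw [hr, hv, ← cfcₙ_mul (fun t : ℝ => √t) (fun t : ℝ => √t / max t l) (F₁ w w)
      (hg := hc.continuousOn)]
    exact cfcₙ_congr fun t ht =>
      (sqrt_mul_sqrt_div_max (quasispectrum_nonneg_of_nonneg _ (hpos₁ w) t ht)).symm
  have e (F : E → E → A) (hF : IsHermitianForm F) : F (v • w) (v • w) = v * F w w * v := by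
    rw [hF.smulA_left, hF.smulA_right, hvs, mul_assoc]
  have hvr : r * v = v * r := by rw [hr, hv]; exact (cfcₙ_commute_cfcₙ _ _ _).eq
  have hle : ‖v * F₂ w w * v‖ ≤ K := by
    rw [← e F₂ h₂]
    refine (hK _).trans ?_
    rw [e F₁ h₁, hv]
    simpa using mul_le_mul_of_nonneg_left (norm_cfcₙ_conj_le (hpos₁ w) hl) hK0
  calc F₂ (cfcₙ (fun t : ℝ => t / max t l) (F₁ w w) • w)
        (cfcₙ (fun t : ℝ => t / max t l) (F₁ w w) • w)
      = star r * (v * F₂ w w * v) * r := by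
        rw [hrv, h₂.smulA_left, h₂.smulA_right, star_mul, hvs, hrs]
        simp only [mul_assoc]
    _ ≤ ‖v * F₂ w w * v‖ • (star r * r) := CStarAlgebra.star_left_conjugate_le_norm_smul (by
        rw [← e F₂ h₂]; exact h₂.isSelfAdjoint _)
    _ = ‖v * F₂ w w * v‖ • F₁ w w := by rw [hrs, hrr]
    _ ≤ K • F₁ w w := smul_le_smul_of_nonneg_right hle (hpos₁ w)

theorem norm_sum_le (h₁ : IsHermitianForm F₁) (h₂ : IsHermitianForm F₂)
    (hpos₁ : ∀ x, 0 ≤ F₁ x x) (hpos₂ : ∀ x, 0 ≤ F₂ x x) (hn : ∀ x, ‖x‖ ^ 2 = ‖F₁ x x‖)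
    {K κ : ℝ} (hK : ∀ x, ‖F₂ x x‖ ≤ K * ‖x‖ ^ 2) (hκ0 : 0 ≤ κ) (hκ : ∀ x, F₂ x x ≤ κ • F₁ x x)
    (hmul : ∀ z w x y, F₂ z w * F₁ x y = F₁ z w * F₂ x y) {ι : Type*} (s : Finset ι)
    (x y : ι → E) :
    ‖∑ i ∈ s, F₂ (x i) (y i)‖ ≤ κ * ‖∑ i ∈ s, F₁ (x i) (y i)‖ := by
  set a₁ := ∑ i ∈ s, F₁ (x i) (y i)
  set a₂ := ∑ i ∈ s, F₂ (x i) (y i) with ha₂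
  obtain ⟨b₁, hb₁⟩ : ∃ b, b = ∑ i ∈ s, F₁ (x i) (x i) := ⟨_, rfl⟩
  obtain ⟨b₂, hb₂⟩ : ∃ b, b = ∑ i ∈ s, F₂ (x i) (x i) := ⟨_, rfl⟩
  have hb₁0 : 0 ≤ b₁ := hb₁ ▸ Finset.sum_nonneg fun i _ => hpos₁ _
  have hb₂0 : 0 ≤ b₂ := hb₂ ▸ Finset.sum_nonneg fun i _ => hpos₂ _
  have hsa : IsSelfAdjoint b₁ := .of_nonneg hb₁0
  have hle : b₂ ≤ κ • b₁ := by
    rw [hb₁, hb₂, Finset.smul_sum]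
    exact Finset.sum_le_sum fun i _ => hκ _
  have hba : b₂ * a₁ = b₁ * a₂ := by
    rw [hb₁, hb₂, Finset.sum_mul_sum, Finset.sum_mul_sum]
    exact Finset.sum_congr rfl fun i _ => Finset.sum_congr rfl fun j _ => hmul _ _ _ _
  have hbb : Commute b₁ b₂ := by
    have : b₂ * b₁ = b₁ * b₂ := by
      rw [hb₁, hb₂, Finset.sum_mul_sum, Finset.sum_mul_sum]
      exact Finset.sum_congr rfl fun i _ => Finset.sum_congr rfl fun j _ => hmul _ _ _ _
    exact this.symm
  have main (l : ℝ) (hl : 0 < l) :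
      ‖cfcₙ (fun t : ℝ => (t / max t l) ^ 2) b₁ * a₂‖ ≤ κ * ‖a₁‖ := by
    have hc : Continuous fun t : ℝ => √t / max t l := by
      simpa using continuous_div_max Real.continuous_sqrt hl 1
    obtain ⟨v, hv⟩ : ∃ v, v = cfcₙ (fun t : ℝ => √t / max t l) b₁ := ⟨_, rfl⟩
    have hvs : star v = v := by rw [hv]; exact (cfcₙ_predicate _ _ : IsSelfAdjoint _).star_eq
    have hvc : Commute v b₂ := by rw [hv]; exact hbb.cfcₙ_real _
    have he : cfcₙ (fun t : ℝ => (t / max t l) ^ 2) b₁ = v * (v * b₁) := by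
      have hvb : cfcₙ (fun t : ℝ => √t / max t l * t) b₁ = v * b₁ := by
        rw [cfcₙ_mul (fun t : ℝ => √t / max t l) (fun t : ℝ => t) b₁ (hf := hc.continuousOn),
          cfcₙ_id' ℝ b₁, hv]
      rw [← hvb, hv, ← cfcₙ_mul (fun t : ℝ => √t / max t l) (fun t : ℝ => √t / max t l * t) b₁
        (hf := hc.continuousOn) (hg := (hc.mul continuous_id).continuousOn)]
      refine cfcₙ_congr fun t ht => ?_
      have ht0 := quasispectrum_nonneg_of_nonneg b₁ hb₁0 t ht
      calc (t / max t l) ^ 2 = t * t / max t l ^ 2 := by ring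
        _ = (√t * √t) * t / max t l ^ 2 := by rw [Real.mul_self_sqrt ht0]
        _ = _ := by ring
    have hvv : v * (v * b₁) * a₂ = v * b₂ * v * a₁ := by
      rw [mul_assoc, mul_assoc, ← hba, hvc.symm.right_comm, mul_assoc, mul_assoc]
    rw [he, hvv]
    refine (norm_mul_le _ _).trans (mul_le_mul_of_nonneg_right ?_ (norm_nonneg _))
    have h0 : 0 ≤ v * b₂ * v := by
      have := star_left_conjugate_nonneg hb₂0 v
      rwa [hvs] at this
    have h1 : v * b₂ * v ≤ κ • (v * b₁ * v) := by
      have := star_left_conjugate_le_conjugate hle v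
      rwa [hvs, mul_smul_comm, smul_mul_assoc] at this
    refine (CStarAlgebra.norm_le_norm_of_nonneg_of_le h0 h1).trans ?_
    rw [norm_smul, Real.norm_of_nonneg hκ0, hv]
    simpa using mul_le_mul_of_nonneg_left (norm_cfcₙ_conj_le hb₁0 hl) hκ0
  have hlim : Filter.Tendsto (fun l : ℝ => cfcₙ (fun t : ℝ => (t / max t l) ^ 2) b₁ * a₂)
      (nhdsWithin 0 (Set.Ioi 0)) (nhds a₂) := by
    simp only [ha₂, Finset.mul_sum]
    refine tendsto_finsetSum _ fun i hi => ?_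
    simp only [← h₂.smulA_left]
    have hxi : F₁ (x i) (x i) ≤ b₁ :=
      hb₁ ▸ Finset.single_le_sum (f := fun i => F₁ (x i) (x i)) (fun j _ => hpos₁ _) hi
    refine h₂.tendsto_apply hK ?_ tendsto_const_nhds
    refine h₁.tendsto_cfcₙ_smul hpos₁ (K := 1) (fun x => by rw [hn, one_mul]) hxi
      (f := fun l t : ℝ => (t / max t l) ^ 2) (fun l hl => ?_)
      (fun l _ => by simp) (fun l hl t ht => mul_one_sub_div_max_sq_sq_le hl ht)
    have : Continuous fun t : ℝ => t / max t l := by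
      simpa using continuous_div_max continuous_id hl 1
    exact this.pow 2
  refine le_of_tendsto hlim.norm ?_
  filter_upwards [self_mem_nhdsWithin] with l hl using main l hl

end Norm

end IsHermitianForm

theorem DoubleCentralizer.exists_central_isUnit_of_norm_lt {A : Type*} [NonUnitalCStarAlgebra A]
    {T : A →L[ℂ] A} (hl : ∀ a c, T (a * c) = a * T c) (hr : ∀ a c, T (a * c) = T a * c)
    (hs : ∀ a, star (T (star a)) = T a) {K : ℝ} (hK : ‖T‖ < K) :
    ∃ γ : 𝓜(ℂ, A), γ ∈ Set.center 𝓜(ℂ, A) ∧ IsUnit γ ∧ (∃ b : 𝓜(ℂ, A), γ = star b * b) ∧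
      ∀ a, γ.fst a = K • a - T a := by
  obtain ⟨t, htf, hts⟩ : ∃ t : 𝓜(ℂ, A), t.fst = T ∧ t.snd = T :=
    ⟨⟨(T, T), fun x y => (hr x y).symm.trans (hl x y)⟩, rfl, rfl⟩
  have hcancel (a b : A) (h : ∀ z, z * a = z * b) : a = b := by
    rw [← sub_eq_zero, ← CStarRing.star_mul_self_eq_zero_iff, mul_sub, h, sub_self]
  have hcancel' (a b : A) (h : ∀ z, a * z = b * z) : a = b := by
    rw [← sub_eq_zero, ← CStarRing.mul_star_self_eq_zero_iff, sub_mul, h, sub_self]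
  have hcomm (m : 𝓜(ℂ, A)) : t * m = m * t := by
    have h1 : t.fst * m.fst = m.fst * t.fst := by
      ext a
      refine hcancel _ _ fun z => ?_
      simp only [htf, mul_apply_eq_comp, ← hl, ← m.central]
    have h2 : m.snd * t.snd = t.snd * m.snd := by
      ext a
      refine hcancel' _ _ fun z => ?_
      simp only [hts, mul_apply_eq_comp, ← hr, m.central]
    exact DoubleCentralizer.ext _ _ _ _ (Prod.ext (by simpa using h1) (by simpa using h2))
  have hnorm : ‖t‖ = ‖T‖ := by rw [← norm_fst, htf]
  have hsa : IsSelfAdjoint t := by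
    refine DoubleCentralizer.ext _ _ _ _ (Prod.ext ?_ ?_) <;> ext a
    · rw [star_fst, hts, htf, hs]
    · rw [star_snd, hts, htf, hs]
  refine ⟨algebraMap ℂ _ (K : ℂ) - t, ?_, ?_, ?_, fun a => ?_⟩
  · rw [Semigroup.mem_center_iff]
    intro m
    rw [mul_sub, sub_mul, hcomm, Algebra.commutes]
  · rcases subsingleton_or_nontrivial 𝓜(ℂ, A) with h | h
    · exact isUnit_of_subsingleton _
    · refine spectrum.mem_resolventSet_of_norm_lt (k := (K : ℂ)) ?_
      rw [hnorm, Complex.norm_real]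
      exact hK.trans_le (le_abs_self K)
  · let _ := CStarAlgebra.spectralOrder 𝓜(ℂ, A)
    have := CStarAlgebra.spectralOrderedRing 𝓜(ℂ, A)
    refine CStarAlgebra.nonneg_iff_eq_star_mul_self.mp (sub_nonneg.mpr ?_)
    refine hsa.le_algebraMap_norm_self.trans ?_
    rw [hnorm]
    have : algebraMap ℂ 𝓜(ℂ, A) (K : ℂ) = algebraMap ℝ 𝓜(ℂ, A) K :=
      (IsScalarTower.algebraMap_apply ℝ ℂ 𝓜(ℂ, A) K).symm
    rw [this]
    exact algebraMap_mono _ hK.le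
  · simp [htf, Algebra.algebraMap_eq_smul_one]

/-- **Corollary 4.6**: let `E` be a full Hilbert `A`-module with inner product `⟪·,·⟫₁`
(inducing the norm of `E`, with `E` complete), and let `⟪·,·⟫₂` be another `A`-valued inner
product on `E` whose induced norm `x ↦ √‖⟪x, x⟫₂‖` is equivalent to the norm of `E`.  If
`⟪x, y⟫₁ = 0` implies `⟪x, y⟫₂ = 0`, then `⟪·,·⟫₂ = γ · ⟪·,·⟫₁` for an invertible positive
central multiplier `γ ∈ Z(M(A))` (acting on `A ⊴ M(A)` via `γ.fst`). -/
theorem second_inner_product_is_central_multiple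
    {A E : Type*} [NonUnitalCStarAlgebra A] [PartialOrder A] [StarOrderedRing A]
    [NormedAddCommGroup E] [Module ℂ E] [SMul A E] [CompleteSpace E]
    (M₁ M₂ : CStarInnerProductModule A E)
    (hnorm₁ : ∀ x : E, ‖x‖ ^ 2 = ‖M₁.inner x x‖)
    (hfull : (Submodule.span ℂ {a : A | ∃ x y : E, a = M₁.inner x y}).topologicalClosure = ⊤)
    (hequiv : ∃ c C : ℝ, 0 < c ∧
      (∀ x : E, c * ‖x‖ ≤ Real.sqrt ‖M₂.inner x x‖) ∧
      (∀ x : E, Real.sqrt ‖M₂.inner x x‖ ≤ C * ‖x‖))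
    (h : ∀ x y : E, M₁.inner x y = 0 → M₂.inner x y = 0) :
    ∃ γ : 𝓜(ℂ, A), γ ∈ Set.center 𝓜(ℂ, A) ∧ IsUnit γ ∧ (∃ b : 𝓜(ℂ, A), γ = star b * b) ∧
      ∀ x y : E, M₂.inner x y = γ.fst (M₁.inner x y) := by
  obtain ⟨c, C, hc, hcl, hCl⟩ := hequiv
  have h₁ := M₁.isHermitianForm
  have h₂ := M₂.isHermitianForm
  have hnorm_smul (a : ℂ) (x : E) : ‖a • x‖ ≤ ‖a‖ * ‖x‖ := by
    refine (sq_le_sq₀ (norm_nonneg _) (by positivity)).mp (le_of_eq ?_)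
    rw [mul_pow, hnorm₁, hnorm₁, h₁.smulC_left, h₁.smulC_right, norm_smul, norm_smul, norm_star]
    ring
  let _ : NormedSpace ℂ E := { ‹Module ℂ E› with norm_smul_le := hnorm_smul }
  have hn₁ (x : E) : ‖x‖ ^ 2 ≤ 1 * ‖M₁.inner x x‖ := by rw [hnorm₁, one_mul]
  have hn₁' (x : E) : ‖M₁.inner x x‖ ≤ 1 * ‖x‖ ^ 2 := by rw [hnorm₁, one_mul]
  have hC (x : E) : ‖M₂.inner x x‖ ≤ C ^ 2 * ‖x‖ ^ 2 := by
    rw [← mul_pow]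
    exact (Real.sqrt_le_iff.mp (hCl x)).2
  have hc' (x : E) : ‖x‖ ^ 2 ≤ (c ^ 2)⁻¹ * ‖M₂.inner x x‖ := by
    rw [le_inv_mul_iff₀ (by positivity), ← mul_pow]
    exact (Real.le_sqrt (by positivity) (norm_nonneg _)).mp (hcl x)
  have hle (x : E) : M₂.inner x x ≤ C ^ 2 • M₁.inner x x :=
    h₁.apply_self_le_smul h₂ M₁.inner_self_nonneg hn₁ hC (sq_nonneg C)
      (fun x => by rw [← hnorm₁]; exact hC x) x
  have hge (x : E) : c ^ 2 • M₁.inner x x ≤ M₂.inner x x := by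
    have := h₂.apply_self_le_smul h₁ M₂.inner_self_nonneg hc' hn₁'
      (inv_nonneg.mpr (sq_nonneg c)) (fun x => by rw [← hnorm₁]; exact hc' x) x
    simpa [smul_smul, hc.ne'] using smul_le_smul_of_nonneg_left this (sq_nonneg c)
  obtain ⟨K, hK⟩ : ∃ K, K = C ^ 2 + c ^ 2 := ⟨_, rfl⟩
  have hN := h₁.smul_sub h₂ K
  have hNpos (x : E) : 0 ≤ K • M₁.inner x x - M₂.inner x x := by
    rw [sub_nonneg, hK, add_smul]
    exact (hle x).trans (le_add_of_nonneg_right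
      (smul_nonneg (sq_nonneg c) (M₁.inner_self_nonneg x)))
  have hNle (x : E) : K • M₁.inner x x - M₂.inner x x ≤ C ^ 2 • M₁.inner x x := by
    rw [sub_le_iff_le_add, hK, add_smul]
    exact add_le_add_right (hge x) _
  have hNnorm (x : E) : ‖K • M₁.inner x x - M₂.inner x x‖ ≤ C ^ 2 * ‖x‖ ^ 2 := by
    refine (CStarAlgebra.norm_le_norm_of_nonneg_of_le (hNpos x) (hNle x)).trans (le_of_eq ?_)
    rw [norm_smul, Real.norm_of_nonneg (sq_nonneg C), hnorm₁]
  have hmul := h₁.mul_eq_mul_of_orthogonality hN M₁.inner_self_nonneg hnorm₁ hNnorm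
    fun x y hxy => by simp [hxy, h x y hxy]
  obtain ⟨T, hT, hTF, hTl, hTr, hTs⟩ := h₁.exists_continuousLinearMap hN hfull (sq_nonneg C)
    (h₁.norm_sum_le hN M₁.inner_self_nonneg hNpos hnorm₁ hNnorm (sq_nonneg C) hNle hmul)
  have hTK : ‖T‖ < K := hT.trans_lt (by rw [hK]; exact lt_add_of_pos_right _ (by positivity))
  obtain ⟨γ, hγ, hγu, hγp, hγf⟩ :=
    DoubleCentralizer.exists_central_isUnit_of_norm_lt hTl hTr hTs hTK
  exact ⟨γ, hγ, hγu, hγp, fun x y => by rw [hγf, hTF, sub_sub_cancel]⟩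
end
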